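/- Theorem (Generalized Knuth equivalence): If two rook placements P and Q on a rectangular Ferrers board differ by a sequence of generalized Knuth transformations, then ins(P) = ins(Q). -/

import Mathlib

open scoped Classical

/-- A cell (square) of the grid: `(column, row)`, both `≥ 1` for genuine cells. -/
abbrev Cell : Type := ℕ × ℕ

/-- The rectangle `R(a,b)` consisting of all cells `(i,j)` with `1 ≤ i ≤ a`, `1 ≤ j ≤ b`. -/
def Rect (a b : ℕ) : Finset Cell := Finset.Icc 1 a ×ˢ Finset.Icc 1 b

/-- A Ferrers board (French notation): a down-left closed finite set of cells with
positive coordinates. -/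
def IsFerrers (F : Finset Cell) : Prop :=
  ∀ p ∈ F, 1 ≤ p.1 ∧ 1 ≤ p.2 ∧
    ∀ q : Cell, 1 ≤ q.1 → 1 ≤ q.2 → q.1 ≤ p.1 → q.2 ≤ p.2 → q ∈ F

/-- A rook placement on a board `F`: a subset of `F` with at most one cell in each
column and at most one cell in each row. -/
def IsPlacement (F P : Finset Cell) : Prop :=
  P ⊆ F ∧ (∀ p ∈ P, ∀ q ∈ P, p.1 = q.1 → p = q) ∧
    (∀ p ∈ P, ∀ q ∈ P, p.2 = q.2 → p = q)

/-- A decreasing sequence in `P`: columns strictly increase, rows strictly decrease. -/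
def IsDecSeq (P : Finset Cell) (k : ℕ) (S : Fin k → Cell) : Prop :=
  (∀ i, S i ∈ P) ∧ ∀ i j : Fin k, i < j → (S i).1 < (S j).1 ∧ (S j).2 < (S i).2

/-- An increasing sequence in `P`: columns and rows both strictly increase. -/
def IsIncSeq (P : Finset Cell) (k : ℕ) (S : Fin k → Cell) : Prop :=
  (∀ i, S i ∈ P) ∧ ∀ i j : Fin k, i < j → (S i).1 < (S j).1 ∧ (S i).2 < (S j).2

/-- Lexicographic comparison of two sequences of cells by their rows (values),
entry by entry from the left. -/
def rowLexLE (k : ℕ) (S T : Fin k → Cell) : Prop :=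
  (∀ i, (S i).2 = (T i).2) ∨
    ∃ i : Fin k, (S i).2 < (T i).2 ∧ ∀ j : Fin k, j < i → (S j).2 = (T j).2

/-- Robinson–Schensted row insertion of a value `v` into one row: returns the new row
and the bumped value (`none` if `v` was appended at the right end). The leftmost entry
strictly larger than `v` is bumped. -/
def rowInsert (v : ℕ) : List ℕ → List ℕ × Option ℕ
  | [] => ([v], none)
  | x :: xs =>
    if v < x then (v :: xs, some x)
    else
      let p := rowInsert v xs
      (x :: p.1, p.2)

/-- Robinson–Schensted insertion of a value into a tableau (a list of rows, top row
first), bumping cascading down the rows. -/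
def tabInsert (v : ℕ) : List (List ℕ) → List (List ℕ)
  | [] => [[v]]
  | row :: rest =>
    match rowInsert v row with
    | (r, none) => r :: rest
    | (r, some b) => r :: tabInsert b rest

/-- The row of the (unique) cell of `P` in column `c`. -/
noncomputable def rowAt (P : Finset Cell) (c : ℕ) : ℕ := sSup {r | (c, r) ∈ P}

/-- The cells of the placement `P`, as (column, row) pairs listed in increasing order
of column: the two-line notation of the corresponding partial permutation. -/
noncomputable def rsSteps (P : Finset Cell) : List (ℕ × ℕ) :=
  ((P.image Prod.fst).sort (· ≤ ·)).map fun c => (c, rowAt P c)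

/-- The index of the (first) row where two tableaux have different lengths. -/
noncomputable def diffRow (T T' : List (List ℕ)) : ℕ :=
  sInf {r | (T.getD r []).length ≠ (T'.getD r []).length}

/-- Append the value `v` at the right end of row `r` of a tableau (creating a new
bottom row when `r` is one past the last row). -/
def placeAt (v : ℕ) : ℕ → List (List ℕ) → List (List ℕ)
  | 0, [] => [[v]]
  | 0, row :: rest => (row ++ [v]) :: rest
  | _ + 1, [] => [[v]]
  | r + 1, row :: rest => row :: placeAt v r rest

/-- The Robinson–Schensted insertion and recording tableaux of the partial permutation
determined by `P`, columns processed in increasing order. -/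
noncomputable def rsPair (P : Finset Cell) : List (List ℕ) × List (List ℕ) :=
  (rsSteps P).foldl
    (fun TR cv =>
      let T' := tabInsert cv.2 TR.1
      (T', placeAt cv.1 (diffRow TR.1 T') TR.2))
    ([], [])

/-- The Robinson–Schensted insertion tableau `ins(P)`. -/
noncomputable def insTab (P : Finset Cell) : List (List ℕ) := (rsPair P).1

/-- The Robinson–Schensted recording tableau `rec(P)`. -/
noncomputable def recTab (P : Finset Cell) : List (List ℕ) := (rsPair P).2

/-- The restriction `P|_{a,b}` of a placement to columns `a` through `b`. -/
def colRestrict (a b : ℕ) (P : Finset Cell) : Finset Cell :=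
  P.filter fun p => a ≤ p.1 ∧ p.1 ≤ b

/-- The sequence obtained from `S = S₁…S_k` by the left shift towards column `a`:
`S_i` moves to the column of `S_{i-1}` for `i > 1`, and `S₁` moves to column `a`;
rows are unchanged. -/
def shiftLSeq (a : ℕ) (k : ℕ) (S : Fin k → Cell) : Fin k → Cell := fun i =>
  (if 0 < i.1 then (S ⟨i.1 - 1, Nat.lt_of_le_of_lt (Nat.sub_le _ _) i.isLt⟩).1 else a,
    (S i).2)

/-- The sequence obtained from `S = S₁…S_k` by the right shift towards column `b`:
`S_i` moves to the column of `S_{i+1}` for `i < k`, and `S_k` moves to column `b`;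
rows are unchanged. -/
def shiftRSeq (b : ℕ) (k : ℕ) (S : Fin k → Cell) : Fin k → Cell := fun i =>
  (if h : i.1 + 1 < k then (S ⟨i.1 + 1, h⟩).1 else b, (S i).2)

/-- The left shift `P(a ← S)` of the subplacement `S` of `P` to column `a`. -/
def leftShift (a : ℕ) (k : ℕ) (S : Fin k → Cell) (P : Finset Cell) : Finset Cell :=
  (P \ Finset.image S Finset.univ) ∪ Finset.image (shiftLSeq a k S) Finset.univ

/-- The right shift `P(S → b)` of the subplacement `S` of `P` to column `b`. -/
def rightShift (b : ℕ) (k : ℕ) (S : Fin k → Cell) (P : Finset Cell) : Finset Cell :=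
  (P \ Finset.image S Finset.univ) ∪ Finset.image (shiftRSeq b k S) Finset.univ

/-- `S` is a longest decreasing sequence in `P|_{a,b}`. -/
def IsMaxDec (a b : ℕ) (P : Finset Cell) (k : ℕ) (S : Fin k → Cell) : Prop :=
  IsDecSeq (colRestrict a b P) k S ∧
    ∀ (l : ℕ) (T : Fin l → Cell), IsDecSeq (colRestrict a b P) l T → l ≤ k

/-- `S = d_{a,b}(P)`: the lexicographically value-smallest longest decreasing sequence
in `P|_{a,b}`. -/
def IsSmallestDec (a b : ℕ) (P : Finset Cell) (k : ℕ) (S : Fin k → Cell) : Prop :=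
  IsMaxDec a b P k S ∧
    ∀ T : Fin k → Cell, IsDecSeq (colRestrict a b P) k T → rowLexLE k S T

/-- `S = D_{a,b}(P)`: the lexicographically value-largest longest decreasing sequence
in `P|_{a,b}`. -/
def IsLargestDec (a b : ℕ) (P : Finset Cell) (k : ℕ) (S : Fin k → Cell) : Prop :=
  IsMaxDec a b P k S ∧
    ∀ T : Fin k → Cell, IsDecSeq (colRestrict a b P) k T → rowLexLE k T S

/-- `S` is a longest increasing sequence in `P|_{a,b}`. -/
def IsMaxInc (a b : ℕ) (P : Finset Cell) (k : ℕ) (S : Fin k → Cell) : Prop :=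
  IsIncSeq (colRestrict a b P) k S ∧
    ∀ (l : ℕ) (T : Fin l → Cell), IsIncSeq (colRestrict a b P) l T → l ≤ k

/-- `S = i_{a,b}(P)`: the lexicographically value-smallest longest increasing sequence
in `P|_{a,b}`. -/
def IsSmallestInc (a b : ℕ) (P : Finset Cell) (k : ℕ) (S : Fin k → Cell) : Prop :=
  IsMaxInc a b P k S ∧
    ∀ T : Fin k → Cell, IsIncSeq (colRestrict a b P) k T → rowLexLE k S T

/-- `S = I_{a,b}(P)`: the lexicographically value-largest longest increasing sequence
in `P|_{a,b}`. -/
def IsLargestInc (a b : ℕ) (P : Finset Cell) (k : ℕ) (S : Fin k → Cell) : Prop :=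
  IsMaxInc a b P k S ∧
    ∀ T : Fin k → Cell, IsIncSeq (colRestrict a b P) k T → rowLexLE k T S

/-- A generalized Knuth transformation on placements on the rectangular board `R(m,n)`:
replace `P` by `P(a ← d_{a,b}(P))` or `P(a ← I_{a,b}(P))` (when column `a` holds no
cell of `P`), or by `P(D_{a,b}(P) → b)` or `P(i_{a,b}(P) → b)` (when column `b` holds
no cell of `P`), for some columns `a < b` of the board. -/
def IsGKT (m : ℕ) (P Q : Finset Cell) : Prop :=
  ∃ a b : ℕ, 1 ≤ a ∧ a < b ∧ b ≤ m ∧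
    (((∀ p ∈ P, p.1 ≠ a) ∧ ∃ (k : ℕ) (S : Fin k → Cell),
        (IsSmallestDec a b P k S ∨ IsLargestInc a b P k S) ∧ Q = leftShift a k S P) ∨
     ((∀ p ∈ P, p.1 ≠ b) ∧ ∃ (k : ℕ) (S : Fin k → Cell),
        (IsLargestDec a b P k S ∨ IsSmallestInc a b P k S) ∧ Q = rightShift b k S P))

/-- An elementary Knuth transformation of words. -/
inductive KnuthStep {α : Type*} [LinearOrder α] : List α → List α → Prop
  | first (p q : List α) {x y z : α} (hxy : x < y) (hyz : y < z) :
      KnuthStep (p ++ y :: z :: x :: q) (p ++ y :: x :: z :: q)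
  | second (p q : List α) {x y z : α} (hxy : x < y) (hyz : y < z) :
      KnuthStep (p ++ x :: z :: y :: q) (p ++ z :: x :: y :: q)

/-- Knuth equivalence of words. -/
def KnuthEquiv {α : Type*} [LinearOrder α] : List α → List α → Prop :=
  Relation.EqvGen KnuthStep

section
variable {α : Type*} [LinearOrder α]

/-- A strictly decreasing word. -/
abbrev Dec (s : List α) : Prop := s.Pairwise (· > ·)

theorem KnuthStep.context {w v : List α} (h : KnuthStep w v) (a b : List α) :
    KnuthStep (a ++ w ++ b) (a ++ v ++ b) := by
  cases h with
  | first p q hxy hyz => simpa using KnuthStep.first (a ++ p) (q ++ b) hxy hyz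
  | second p q hxy hyz => simpa using KnuthStep.second (a ++ p) (q ++ b) hxy hyz

theorem KnuthStep.perm {w v : List α} (h : KnuthStep w v) : w.Perm v := by
  cases h with
  | first p q hxy hyz => exact ((List.Perm.swap _ _ _).cons _).append_left _
  | second p q hxy hyz => exact (List.Perm.swap _ _ _).append_left _

theorem KnuthEquiv.perm {w v : List α} (h : KnuthEquiv w v) : w.Perm v := by
  induction h with
  | rel _ _ h => exact h.perm
  | refl => exact .refl _
  | symm _ _ _ ih => exact ih.symm
  | trans _ _ _ _ _ ih ih' => exact ih.trans ih'

theorem KnuthEquiv.context {w v : List α} (h : KnuthEquiv w v) (a b : List α) :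
    KnuthEquiv (a ++ w ++ b) (a ++ v ++ b) := by
  induction h with
  | rel _ _ h => exact .rel _ _ (h.context a b)
  | refl => exact .refl _
  | symm _ _ _ ih => exact ih.symm
  | trans _ _ _ _ _ ih ih' => exact ih.trans _ _ _ ih'

/-- `s` is a longest decreasing subword of `w`, and entrywise the smallest such. -/
structure IsLeastDec (w s : List α) : Prop where
  sublist : s.Sublist w
  dec : Dec s
  length_le : ∀ t : List α, t.Sublist w → Dec t → t.length ≤ s.length
  le : ∀ t : List α, t.Sublist w → Dec t → t.length = s.length → List.Forall₂ (· ≤ ·) s t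

/-- The marked letters of a marked word. -/
def marked {β : Type*} (M : List (β × Bool)) : List β := (M.filter Prod.snd).map Prod.fst

/-- Replace each marked letter by the next marked one (the letters of `n` being marked letters
further to the right); the last marked letter disappears if `n` is empty. -/
def shiftMarked {β : Type*} (n : List β) : List (β × Bool) → List β
  | [] => []
  | (a, false) :: M => a :: shiftMarked n M
  | (_, true) :: M => (marked M ++ n).head?.toList ++ shiftMarked n M

/-- Shift of the marked letters to the left, the first one moving to the front. -/
def frontShift {β : Type*} (M : List (β × Bool)) : List β :=
  (marked M).head?.toList ++ shiftMarked [] M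

@[simp] theorem marked_nil {β : Type*} : marked ([] : List (β × Bool)) = [] := rfl
@[simp] theorem marked_cons_true {β : Type*} (a : β) (M : List (β × Bool)) :
    marked ((a, true) :: M) = a :: marked M := by simp [marked]
@[simp] theorem marked_cons_false {β : Type*} (a : β) (M : List (β × Bool)) :
    marked ((a, false) :: M) = marked M := by simp [marked]
@[simp] theorem marked_append {β : Type*} (M N : List (β × Bool)) :
    marked (M ++ N) = marked M ++ marked N := by simp [marked]

theorem marked_sublist {β : Type*} (M : List (β × Bool)) :
    (marked M).Sublist (M.map Prod.fst) := List.filter_sublist.map _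

theorem shiftMarked_append {β : Type*} (n : List β) (M N : List (β × Bool)) :
    shiftMarked n (M ++ N) = shiftMarked (marked N ++ n) M ++ shiftMarked n N := by
  induction M with
  | nil => rfl
  | cons c M ih => rcases c with ⟨a, _ | _⟩ <;> simp [shiftMarked, ih]

theorem knuthEquiv_first {x y z : α} (hxy : x < y) (hyz : y < z) :
    KnuthEquiv [y, z, x] [y, x, z] := .rel _ _ (.first [] [] hxy hyz)
theorem knuthEquiv_second {x y z : α} (hxy : x < y) (hyz : y < z) :
    KnuthEquiv [x, z, y] [z, x, y] := .rel _ _ (.second [] [] hxy hyz)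

theorem frontShift_equiv (p m m' q : List (α × Bool))
    (hh : (marked m ++ marked q).head? = (marked m' ++ marked q).head?)
    (h : KnuthEquiv (shiftMarked (marked q) m) (shiftMarked (marked q) m')) :
    KnuthEquiv (frontShift (p ++ (m ++ q))) (frontShift (p ++ (m' ++ q))) := by
  have key : ∀ (n n' : List α), n.head? = n'.head? → shiftMarked n p = shiftMarked n' p := by
    intro n n' hn
    induction p with
    | nil => rfl
    | cons c p ih => rcases c with ⟨a, _ | _⟩ <;> simp [shiftMarked, ih, hn]
  simp only [frontShift, shiftMarked_append, marked_append, List.append_nil]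
  rw [key _ _ hh]
  have := h.context ((marked p ++ (marked m' ++ marked q)).head?.toList ++
    shiftMarked (marked m' ++ marked q) p) (shiftMarked [] q)
  simp only [List.head?_append] at *
  simpa [hh] using this

theorem sublist_triple {β : Type*} {a b c : β} {u : List β} (h : u.Sublist [a, b, c]) :
    u = [] ∨ u = [a] ∨ u = [b] ∨ u = [c] ∨ u = [a, b] ∨ u = [a, c] ∨ u = [b, c] ∨
      u = [a, b, c] := by
  have := List.mem_sublists.2 h
  simp [List.sublists] at this
  tauto

theorem first_dec {p q : List α} {x y z : α} {t : List α} (hxy : x < y) (hyz : y < z)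
    (ht : t.Sublist (p ++ y :: x :: z :: q)) (hd : Dec t) :
    t.Sublist (p ++ y :: z :: x :: q) := by
  obtain ⟨t₁, t₂, rfl, h₁, h₂⟩ := List.sublist_append_iff.1 ht
  refine h₁.append ?_
  obtain ⟨u, t₃, rfl, h₂, h₃⟩ :=
    List.sublist_append_iff.1 (show t₂.Sublist ([y, x, z] ++ q) from h₂)
  refine List.Sublist.append (?_ : u.Sublist [y, z, x]) h₃
  have hd₂ : Dec u := (List.pairwise_append.1 (List.pairwise_append.1 hd).2.1).1
  rcases sublist_triple h₂ with rfl | rfl | rfl | rfl | rfl | rfl | rfl | rfl <;>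
    simp [(hxy.trans hyz).not_gt, hyz.not_gt] at hd₂ ⊢

theorem second_dec {p q : List α} {x y z : α} {t : List α} (hxy : x < y)
    (ht : t.Sublist (p ++ z :: x :: y :: q)) (hd : Dec t) :
    t.Sublist (p ++ x :: z :: y :: q) ∨
      ∃ t₁ t₂, t = t₁ ++ z :: x :: t₂ ∧ t₁.Sublist p ∧ t₂.Sublist q := by
  obtain ⟨t₁, t₂, rfl, h₁, h₂⟩ := List.sublist_append_iff.1 ht
  obtain ⟨u, t₃, rfl, h₂, h₃⟩ :=
    List.sublist_append_iff.1 (show t₂.Sublist ([z, x, y] ++ q) from h₂)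
  have hd₂ : Dec u := (List.pairwise_append.1 (List.pairwise_append.1 hd).2.1).1
  by_cases hu : u = [z, x]
  · subst hu
    exact .inr ⟨t₁, t₃, rfl, h₁, h₃⟩
  · refine .inl (h₁.append (List.Sublist.append (?_ : u.Sublist [x, z, y]) h₃))
    rcases sublist_triple h₂ with rfl | rfl | rfl | rfl | rfl | rfl | rfl | rfl <;>
      simp [hxy.not_gt] at hu hd₂ ⊢

theorem step_dec {w v t : List α} (h : KnuthStep w v) (ht : t.Sublist v) (hd : Dec t) :
    ∃ t', t'.Sublist w ∧ Dec t' ∧ t'.length = t.length := by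
  cases h with
  | first p q hxy hyz => exact ⟨t, first_dec hxy hyz ht hd, hd, rfl⟩
  | @second p q x y z hxy hyz =>
    rcases second_dec hxy ht hd with h | ⟨t₁, t₂, rfl, h₁, h₂⟩
    · exact ⟨t, h, hd, rfl⟩
    · refine ⟨t₁ ++ z :: y :: t₂, h₁.append ?_, ?_, by simp⟩
      · exact ((h₂.cons_cons y).cons_cons z).cons x
      · simp only [Dec, List.pairwise_append, List.pairwise_cons, List.mem_cons] at hd ⊢
        grind

theorem forall₂_mid {p p' r r' : List α} {a b : α}
    (h : List.Forall₂ (· ≤ ·) (p ++ a :: r) (p' ++ b :: r')) (hl : p.length = p'.length) :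
    a ≤ b := by
  induction p generalizing p' with
  | nil =>
    obtain rfl : p' = [] := List.length_eq_zero_iff.1 hl.symm
    exact (List.forall₂_cons.1 h).1
  | cons c p ih =>
    rcases p' with _ | ⟨d, p'⟩
    · simp at hl
    · exact ih (List.forall₂_cons.1 h).2 (by simpa using hl)

theorem IsLeastDec.first {p q s : List α} {x y z : α} (hxy : x < y) (hyz : y < z)
    (h : IsLeastDec (p ++ y :: z :: x :: q) s) (hs : s.Sublist (p ++ y :: x :: z :: q)) :
    IsLeastDec (p ++ y :: x :: z :: q) s :=
  ⟨hs, h.dec, fun t ht hd => h.length_le t (first_dec hxy hyz ht hd) hd,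
    fun t ht hd => h.le t (first_dec hxy hyz ht hd) hd⟩

theorem Dec.replace {p u u' q : List α} (h : Dec (p ++ (u ++ q))) (hu : Dec u')
    (h₁ : ∀ e ∈ u', ∃ e₀ ∈ u, e ≤ e₀) (h₂ : ∀ e ∈ u', ∀ n ∈ q.head?, n < e) :
    Dec (p ++ (u' ++ q)) := by
  simp only [Dec, List.pairwise_append, List.mem_append] at h ⊢
  obtain ⟨hp, ⟨-, hq, -⟩, hpu⟩ := h
  refine ⟨hp, ⟨hu, hq, fun e he n hn => ?_⟩, fun a ha b hb => ?_⟩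
  · rcases q with _ | ⟨m, q⟩
    · simp at hn
    · have hm := h₂ e he m (by simp)
      rcases List.mem_cons.1 hn with rfl | hn
      · exact hm
      · exact (List.rel_of_pairwise_cons hq hn).trans hm
  · rcases hb with hb | hb
    · obtain ⟨e₀, he₀, hle⟩ := h₁ b hb
      exact hle.trans_lt (hpu a ha e₀ (.inl he₀))
    · exact hpu a ha b (.inr hb)

theorem exists_marked_first {p q : List (α × Bool)} {x y z : α} {a b c : Bool}
    (hxy : x < y) (hyz : y < z)
    (hn : (p.map Prod.fst ++ y :: z :: x :: q.map Prod.fst).Nodup)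
    (h : IsLeastDec (p.map Prod.fst ++ y :: z :: x :: q.map Prod.fst)
      (marked (p ++ ([(y, a), (z, b), (x, c)] ++ q)))) :
    ∃ M' : List (α × Bool), M'.map Prod.fst = p.map Prod.fst ++ y :: x :: z :: q.map Prod.fst ∧
      IsLeastDec (p.map Prod.fst ++ y :: x :: z :: q.map Prod.fst) (marked M') ∧
      KnuthEquiv (frontShift (p ++ ([(y, a), (z, b), (x, c)] ++ q))) (frontShift M') := by
  have hd := h.dec
  have hle := h.le
  have hmax := h.length_le
  simp only [marked_append] at hd hle hmax
  have hxz := hxy.trans hyz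
  have sub : ∀ u : List α, u.Sublist [y, z, x] → (marked p ++ (u ++ marked q)).Sublist
      (p.map Prod.fst ++ y :: z :: x :: q.map Prod.fst) := fun u hu =>
    (marked_sublist p).append (hu.append (marked_sublist q))
  have hne : ∀ e ∈ [y, z, x], ∀ n ∈ (marked q).head?, n ≠ e := by
    rintro e he n hnq rfl
    have hnq := (marked_sublist q).subset (List.mem_of_mem_head? hnq)
    have hn' : ([y, z, x] ++ q.map Prod.fst).Nodup := (List.nodup_append.1 hn).2.1
    exact List.disjoint_of_nodup_append hn' he hnq
  have hbc : ¬ (b = true ∧ c = true) := by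
    rintro ⟨rfl, rfl⟩
    cases a
    · have := hle _ (sub [y, x] (by simp)) (hd.replace (by simpa using hxy)
        (by simp [hxz.le, hyz.le]) ?_) (by simp)
      · exact (forall₂_mid this rfl).not_gt hyz
      · rcases hq : marked q with _ | ⟨n, sq⟩
        · simp
        · have hnx : n < x := by simp [Dec, List.pairwise_append, hq] at hd; tauto
          simp [hnx, hnx.trans hxy]
    · simp [Dec, List.pairwise_append, hyz.not_gt] at hd
  refine ⟨p ++ ([(y, a), (x, c), (z, b)] ++ q), by simp, ?_, ?_⟩
  · have : marked (p ++ ([(y, a), (z, b), (x, c)] ++ q)) =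
        marked (p ++ ([(y, a), (x, c), (z, b)] ++ q)) := by
      rcases b <;> rcases c <;> rcases a <;> simp at hbc ⊢
    rw [this] at h
    exact h.first hxy hyz (by simpa using marked_sublist (p ++ ([(y, a), (x, c), (z, b)] ++ q)))
  · apply frontShift_equiv
    · rcases b <;> rcases c <;> rcases a <;> simp at hbc ⊢
    rcases hq : marked q with _ | ⟨n, sq⟩ <;> rcases a <;> rcases b <;> rcases c <;>
      simp at hbc <;>
      simp only [shiftMarked, marked_nil, marked_cons_true, marked_cons_false, List.nil_append, List.append_nil, List.cons_append,
        List.head?_nil, List.head?_cons, Option.toList] <;>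
      simp only [hq, marked_nil, marked_cons_true, marked_cons_false, List.nil_append] at hd hle hmax sub
    · exact knuthEquiv_first hxy hyz
    · exact .refl _
    · exact .refl _
    · have := hmax _ (sub [y, x] (by simp)) (hd.replace (by simpa using hxy) (by simp [hxy.le])
        (by simp))
      simp at this
    · exact .refl _
    · exact .refl _
    · exact knuthEquiv_first hxy hyz
    · have hnx : n < x := by simp [Dec, List.pairwise_append] at hd; tauto
      exact knuthEquiv_first (hnx.trans hxy) hyz
    · have hnz : n < z := by simp [Dec, List.pairwise_append] at hd; tauto
      have hyn : y < n := by
        by_contra hyn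
        have := hle _ (sub [y] (by simp)) (hd.replace (by simp) (by simp [hyz.le])
          (by simpa using lt_of_le_of_ne (not_lt.1 hyn) (hne y (by simp) n (by simp [hq])))) (by simp)
        exact (forall₂_mid this rfl).not_gt hyz
      exact knuthEquiv_first hxy hyn
    · have hny : n < y := by simp [Dec, List.pairwise_append] at hd; tauto
      have hxn : x < n := by
        by_contra hxn
        have := hmax _ (sub [y, x] (by simp)) (hd.replace (by simpa using hxy) (by simp [hxy.le])
          (by simpa using ⟨hny, lt_of_le_of_ne (not_lt.1 hxn) (hne x (by simp) n (by simp [hq]))⟩))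
        simp at this
      exact knuthEquiv_first hxn (hny.trans hyz)
    · have hnx : n < x := by simp [Dec, List.pairwise_append] at hd; tauto
      exact knuthEquiv_first hnx hxz
    · simp [Dec, List.pairwise_append, hyz.not_gt] at hd

theorem Dec.glue {a b : List α} {c d : α} (h₁ : Dec (a ++ [c])) (h₂ : Dec (d :: b)) (h : d < c) :
    Dec ((a ++ [c]) ++ d :: b) := by
  refine List.pairwise_append.2 ⟨h₁, h₂, fun e he f hf => ?_⟩
  have hce : c ≤ e := by
    rcases List.mem_append.1 he with he' | he'
    · exact ((List.pairwise_append.1 h₁).2.2 e he' c (by simp)).le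
    · simp at he'
      exact he'.ge
  have hfd : f ≤ d := by
    rcases List.mem_cons.1 hf with rfl | hf'
    · exact le_rfl
    · exact (List.rel_of_pairwise_cons h₂ hf').le
  exact (hfd.trans_lt h).trans_le hce

theorem exists_of_forall₂ {s t : List α} (h : List.Forall₂ (· ≤ ·) s t) :
    ∀ a ∈ s, ∃ b ∈ t, a ≤ b := by
  induction h with
  | nil => simp
  | cons h _ ih =>
    intro a ha
    rcases List.mem_cons.1 ha with rfl | ha
    · exact ⟨_, by simp, h⟩
    · obtain ⟨b, hb, hab⟩ := ih a ha
      exact ⟨b, by simp [hb], hab⟩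

theorem forall₂_trans {s t u : List α} (h : List.Forall₂ (· ≤ ·) s t)
    (h' : List.Forall₂ (· ≤ ·) t u) : List.Forall₂ (· ≤ ·) s u := by
  induction h generalizing u with
  | nil => exact h'
  | cons h _ ih =>
    obtain ⟨b, v, hb, hv, rfl⟩ := List.forall₂_cons_left_iff.1 h'
    exact .cons (h.trans hb) (ih hv)

theorem eq_of_append_cons_sublist_triple {x y z c : α} {e e' : List α} (hyz : y < z)
    (hu : (e ++ c :: e').Sublist [x, z, y]) (hce : ∀ a ∈ e, c < a) (hcx : x < c) (hcy : c ≤ y) :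
    c = y ∧ e' = [] ∧ (e = [] ∨ e = [z]) := by
  rcases e with _ | ⟨e₁, _ | ⟨e₂, _ | ⟨e₃, e⟩⟩⟩ <;>
    rcases sublist_triple hu with h | h | h | h | h | h | h | h <;>
    simp at h hce <;> grind

theorem IsLeastDec.second_le {p q s t₁ t₂ : List α} {x y z : α} (hxy : x < y) (hyz : y < z)
    (hn : (p ++ x :: z :: y :: q).Nodup) (h : IsLeastDec (p ++ x :: z :: y :: q) s)
    (ht₁ : t₁.Sublist p) (ht₂ : t₂.Sublist q) (hd : Dec (t₁ ++ z :: x :: t₂))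
    (hl : (t₁ ++ z :: x :: t₂).length = s.length) :
    List.Forall₂ (· ≤ ·) s (t₁ ++ z :: x :: t₂) ∨
      ∃ s₁ s₂, s = s₁ ++ z :: y :: s₂ ∧ s₁.Sublist p ∧ s₂.Sublist q ∧
        List.Forall₂ (· ≤ ·) s₁ t₁ ∧ List.Forall₂ (· ≤ ·) s₂ t₂ ∧ ∀ n ∈ s₂, n < x := by
  have hzx := hxy.trans hyz
  have hz : Dec (t₁ ++ [z]) := hd.sublist (by simp)
  have hx : Dec (x :: t₂) := hd.sublist (by simp)
  have hy : Dec (y :: t₂) := List.pairwise_cons.2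
    ⟨fun e he => (List.rel_of_pairwise_cons hx he).trans hxy, (List.pairwise_cons.1 hx).2⟩
  have hzy : Dec (t₁ ++ z :: y :: t₂) := by simpa using hz.glue hy hyz
  have hle := h.le (t₁ ++ z :: y :: t₂)
    (ht₁.append (((ht₂.cons_cons y).cons_cons z).cons x)) hzy (by simpa using hl)
  obtain ⟨s₁, c, s₂, rfl, hs₁, hcy, hs₂⟩ : ∃ s₁ c s₂, s = s₁ ++ c :: s₂ ∧
      List.Forall₂ (· ≤ ·) s₁ (t₁ ++ [z]) ∧ c ≤ y ∧ List.Forall₂ (· ≤ ·) s₂ t₂ := by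
    rw [show t₁ ++ z :: y :: t₂ = (t₁ ++ [z]) ++ y :: t₂ by simp] at hle
    have h₁ := List.forall₂_take_append _ _ _ hle
    have h₂ := List.forall₂_drop_append _ _ _ hle
    obtain ⟨c, s₂, hc, h₃, h₄⟩ := List.forall₂_cons_right_iff.1 h₂
    exact ⟨_, c, s₂, by rw [← h₄, List.take_append_drop], h₁, hc, h₃⟩
  by_cases hcx : c ≤ x
  · left
    rw [show t₁ ++ z :: x :: t₂ = (t₁ ++ [z]) ++ x :: t₂ by simp]
    exact List.rel_append hs₁ (.cons hcx hs₂)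
  rw [not_le] at hcx
  have hlen₁ := hs₁.length_eq
  have hlen₂ := hs₂.length_eq
  simp only [List.length_append, List.length_cons, List.length_nil] at hlen₁
  have hsd := h.dec
  obtain ⟨sp, u', hs, hsp, hu'⟩ := List.sublist_append_iff.1 h.sublist
  obtain ⟨u, sq, rfl, hu, hsq⟩ :=
    List.sublist_append_iff.1 (show u'.Sublist ([x, z, y] ++ q) from hu')
  have hc₁ : Dec (s₁ ++ [c]) := hsd.sublist (by simp)
  have hc₂ : Dec (c :: s₂) := hsd.sublist (by simp)
  have hcp : (s₁ ++ [c]).Sublist p → False := fun hsub => by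
    have := h.length_le _ (hsub.append ((ht₂.cons y).cons z |>.cons_cons x)) (hc₁.glue hx hcx)
    simp only [List.length_append, List.length_cons, List.length_nil] at this
    omega
  have hcq : (c :: s₂).Sublist q → False := fun hsub => by
    have hcy' : c < y := by
      refine lt_of_le_of_ne hcy ?_
      rintro rfl
      have hn' : ([x, z, c] ++ q).Nodup := (List.nodup_append.1 hn).2.1
      exact List.disjoint_of_nodup_append hn' (a := c) (by simp) (hsub.subset (by simp))
    have := h.length_le (t₁ ++ ([z] ++ y :: c :: s₂))
      (ht₁.append (((hsub.cons_cons y).cons_cons z).cons x))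
      (by simpa using hz.glue (Dec.glue (a := []) (c := y) (by simp) hc₂ hcy') hyz)
    simp only [List.length_append, List.length_cons, List.length_nil] at this
    omega
  obtain ⟨e, rfl, heu⟩ : ∃ e, s₁ = sp ++ e ∧ u ++ sq = e ++ c :: s₂ := by
    rcases List.append_eq_append_iff.1 hs with ⟨_ | ⟨c', e⟩, rfl, he⟩ | ⟨e, rfl, he⟩
    · exact ⟨[], by simp, by simpa using he.symm⟩
    · obtain ⟨rfl, -⟩ := List.cons.inj he
      exact (hcp (List.Sublist.trans (by simp) hsp)).elim
    · exact ⟨e, rfl, he⟩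
  obtain ⟨e', rfl, rfl⟩ : ∃ e', u = e ++ c :: e' ∧ s₂ = e' ++ sq := by
    rcases List.append_eq_append_iff.1 heu with ⟨e', rfl, rfl⟩ | ⟨_ | ⟨c', e'⟩, rfl, he⟩
    · exact (hcq (List.Sublist.trans (by simp) hsq)).elim
    · exact (hcq (by rw [he]; exact hsq)).elim
    · obtain ⟨rfl, rfl⟩ := List.cons.inj he
      exact ⟨e', rfl, rfl⟩
  have hce : ∀ a ∈ e, c < a := fun a ha =>
    (List.pairwise_append.1 hc₁).2.2 a (by simp [ha]) c (by simp)
  obtain ⟨rfl, rfl, he⟩ := eq_of_append_cons_sublist_triple hyz hu hce hcx hcy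
  rcases he with rfl | rfl
  · rw [List.append_nil] at *
    have := h.le (sp ++ x :: t₂) (hsp.append ((ht₂.cons c).cons z |>.cons_cons x))
      ((hc₁.glue hx hcx).sublist (by simp)) (by simp at hlen₂ ⊢; omega)
    exact ((forall₂_mid this rfl).not_gt hcx).elim
  · refine .inr ⟨sp, sq, by simp, hsp, hsq, ?_, hs₂, ?_⟩
    · have := List.forall₂_take t₁.length hs₁
      have hl : sp.length = t₁.length := by simpa using hlen₁
      rwa [List.take_left' hl, List.take_left' rfl] at this
    · intro n hn
      obtain ⟨m, hm, hnm⟩ := exists_of_forall₂ hs₂ n hn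
      exact hnm.trans_lt (List.rel_of_pairwise_cons hx hm)

theorem IsLeastDec.second {p q s : List α} {x y z : α} (hxy : x < y) (hyz : y < z)
    (hn : (p ++ x :: z :: y :: q).Nodup) (h : IsLeastDec (p ++ x :: z :: y :: q) s)
    (hs : s.Sublist (p ++ z :: x :: y :: q))
    (hne : ∀ s₁ s₂, s = s₁ ++ z :: y :: s₂ → s₁.Sublist p → s₂.Sublist q →
      ∃ n ∈ s₂, x ≤ n) :
    IsLeastDec (p ++ z :: x :: y :: q) s := by
  refine ⟨hs, h.dec, fun t ht hd => ?_, fun t ht hd hl => ?_⟩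
  · obtain ⟨t', ht', hd', hl⟩ := step_dec (.second p q hxy hyz) ht hd
    exact hl ▸ h.length_le t' ht' hd'
  · rcases second_dec hxy ht hd with ht | ⟨t₁, t₂, rfl, h₁, h₂⟩
    · exact h.le t ht hd hl
    · rcases h.second_le hxy hyz hn h₁ h₂ hd hl with h' | ⟨s₁, s₂, h₃, h₄, h₅, -, -, h₆⟩
      · exact h'
      · obtain ⟨n, hn, hxn⟩ := hne s₁ s₂ h₃ h₄ h₅
        exact ((h₆ n hn).not_ge hxn).elim

theorem IsLeastDec.second_swap {p q s₁ s₂ : List α} {x y z : α} (hxy : x < y) (hyz : y < z)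
    (hn : (p ++ x :: z :: y :: q).Nodup)
    (h : IsLeastDec (p ++ x :: z :: y :: q) (s₁ ++ ([z, y] ++ s₂)))
    (h₁ : s₁.Sublist p) (h₂ : s₂.Sublist q) (hx : ∀ n ∈ s₂.head?, n < x) :
    IsLeastDec (p ++ z :: x :: y :: q) (s₁ ++ ([z, x] ++ s₂)) := by
  have hle : List.Forall₂ (· ≤ ·) (s₁ ++ ([z, x] ++ s₂)) (s₁ ++ ([z, y] ++ s₂)) :=
    List.rel_append (List.forall₂_refl _)
      (List.rel_append (.cons le_rfl (.cons hxy.le .nil)) (List.forall₂_refl _))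
  have tr : ∀ {t : List α}, List.Forall₂ (· ≤ ·) (s₁ ++ ([z, y] ++ s₂)) t →
      List.Forall₂ (· ≤ ·) (s₁ ++ ([z, x] ++ s₂)) t := fun h => forall₂_trans hle h
  refine ⟨h₁.append (((h₂.cons y).cons_cons x).cons_cons z), ?_, fun t ht hd => ?_,
    fun t ht hd hl => ?_⟩
  · refine h.dec.replace (by simpa using hxy.trans hyz) (by simp [(hxy.trans hyz).le]) ?_
    intro e he n hn
    have := hx n hn
    simp at he
    rcases he with rfl | rfl
    · exact this.trans (hxy.trans hyz)
    · exact this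
  · obtain ⟨t', ht', hd', hl⟩ := step_dec (.second p q hxy hyz) ht hd
    simpa [hl] using h.length_le t' ht' hd'
  · have hl' : t.length = (s₁ ++ ([z, y] ++ s₂)).length := by simpa using hl
    rcases second_dec hxy ht hd with ht | ⟨t₁, t₂, rfl, h₃, h₄⟩
    · exact tr (h.le t ht hd hl')
    · rcases h.second_le hxy hyz hn h₃ h₄ hd hl' with h' | ⟨s₃, s₄, h₅, h₆, h₇, h₈, h₉, -⟩
      · exact tr h'
      · have hnp : z ∉ p := fun hz => (List.nodup_append.1 hn).2.2 z hz z (by simp) rfl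
        have hn' : ([x, z, y] ++ q).Nodup := (List.nodup_append.1 hn).2.1
        have hnq : z ∉ q := fun hz => List.disjoint_of_nodup_append hn' (by simp) hz
        have hz₃ : z ∉ y :: s₄ := by
          simpa [hyz.ne'] using fun h => hnq (h₇.subset h)
        obtain ⟨rfl, -, h₅⟩ := (List.append_cons_inj_of_notMem (x₂ := s₁) (z₂ := y :: s₂)
          (fun h => hnp (h₆.subset h)) hz₃).1 h₅.symm
        obtain ⟨-, rfl⟩ := List.cons.inj h₅
        exact List.rel_append h₈ (.cons le_rfl (.cons le_rfl h₉))

theorem exists_marked_second {p q : List (α × Bool)} {x y z : α} {a b c : Bool}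
    (hxy : x < y) (hyz : y < z)
    (hn : (p.map Prod.fst ++ x :: z :: y :: q.map Prod.fst).Nodup)
    (h : IsLeastDec (p.map Prod.fst ++ x :: z :: y :: q.map Prod.fst)
      (marked (p ++ ([(x, a), (z, b), (y, c)] ++ q)))) :
    ∃ M' : List (α × Bool), M'.map Prod.fst = p.map Prod.fst ++ z :: x :: y :: q.map Prod.fst ∧
      IsLeastDec (p.map Prod.fst ++ z :: x :: y :: q.map Prod.fst) (marked M') ∧
      KnuthEquiv (frontShift (p ++ ([(x, a), (z, b), (y, c)] ++ q))) (frontShift M') := by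
  have hd := h.dec
  have hle := h.le
  have hmax := h.length_le
  simp only [marked_append] at hd hle hmax
  have hxz := hxy.trans hyz
  have sub : ∀ u : List α, u.Sublist [x, z, y] → (marked p ++ (u ++ marked q)).Sublist
      (p.map Prod.fst ++ x :: z :: y :: q.map Prod.fst) := fun u hu =>
    (marked_sublist p).append (hu.append (marked_sublist q))
  have hnq : ([x, z, y] ++ q.map Prod.fst).Nodup := (List.nodup_append.1 hn).2.1
  have hne : ∀ e ∈ [x, z, y], ∀ n ∈ (marked q).head?, n ≠ e := by
    rintro e he n hnq' rfl
    exact List.disjoint_of_nodup_append hnq he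
      ((marked_sublist q).subset (List.mem_of_mem_head? hnq'))
  have hab : ¬ (a = true ∧ (b = true ∨ c = true)) := by
    rintro ⟨rfl, rfl | rfl⟩
    · simp [Dec, List.pairwise_append, hxz.not_gt] at hd
    · rcases b <;> simp [Dec, List.pairwise_append, hxy.not_gt] at hd
  by_cases hex : b = true ∧ c = true ∧ ∀ n ∈ (marked q).head?, n < x
  · obtain ⟨rfl, rfl, hx⟩ := hex
    obtain rfl : a = false := by simpa using hab
    refine ⟨p ++ ([(z, true), (x, true), (y, false)] ++ q), by simp, ?_, ?_⟩
    · have h' : IsLeastDec (p.map Prod.fst ++ x :: z :: y :: q.map Prod.fst)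
          (marked p ++ ([z, y] ++ marked q)) := by simpa using h
      simpa using h'.second_swap hxy hyz hn (marked_sublist p) (marked_sublist q) hx
    · apply frontShift_equiv
      · simp
      · rcases hq : marked q with _ | ⟨n, sq⟩ <;>
          simp only [shiftMarked, marked_nil, marked_cons_true, marked_cons_false,
            List.nil_append, List.append_nil, List.cons_append, List.head?_nil, List.head?_cons,
            Option.toList]
        · exact .refl _
        · exact knuthEquiv_first (hx n (by simp [hq])) hxy
  · refine ⟨p ++ ([(z, b), (x, a), (y, c)] ++ q), by simp, ?_, ?_⟩
    · have hm : marked (p ++ ([(x, a), (z, b), (y, c)] ++ q)) =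
          marked (p ++ ([(z, b), (x, a), (y, c)] ++ q)) := by
        rcases b <;> rcases c <;> rcases a <;> simp at hab ⊢
      rw [hm] at h
      refine h.second hxy hyz hn
        (by simpa using marked_sublist (p ++ ([(z, b), (x, a), (y, c)] ++ q))) ?_
      intro s₁ s₂ hs h₁ h₂
      have hmem : ∀ e ∈ [x, z, y], e ∈ s₁ ++ z :: y :: s₂ →
          e ∈ marked [(x, a), (z, b), (y, c)] := by
        intro e he hes
        rw [← hs, ← hm, marked_append, marked_append, List.mem_append, List.mem_append] at hes
        rcases hes with hes | hes | hes
        · exact (List.disjoint_of_nodup_append hn ((marked_sublist p).subset hes)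
            (List.mem_append_left (q.map Prod.fst) he)).elim
        · exact hes
        · exact (List.disjoint_of_nodup_append hnq he ((marked_sublist q).subset hes)).elim
      have hb : b = true := by
        have := hmem z (by simp) (by simp)
        rcases a <;> rcases b <;> rcases c <;> simp [hxz.ne', hyz.ne'] at this ⊢
      have hc : c = true := by
        have := hmem y (by simp) (by simp)
        rcases a <;> rcases b <;> rcases c <;> simp [hxy.ne', hyz.ne] at this ⊢
      have hex' : ∃ n ∈ (marked q).head?, x ≤ n := by
        simpa [hb, hc] using hex
      obtain ⟨n, hnq', hxn⟩ := hex'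
      refine ⟨n, ?_, hxn⟩
      have hnm := List.mem_of_mem_head? hnq'
      have hns : n ∈ s₁ ++ z :: y :: s₂ := by
        rw [← hs, ← hm, marked_append, marked_append]
        simp [hnm]
      have hnq'' := (marked_sublist q).subset hnm
      rcases List.mem_append.1 hns with hns | hns
      · exact (List.disjoint_of_nodup_append hn (h₁.subset hns)
          (List.mem_append_right [x, z, y] hnq'')).elim
      · have h₂ := hne z (by simp) n hnq'
        have h₃ := hne y (by simp) n hnq'
        simpa [h₂, h₃] using hns
    · apply frontShift_equiv
      · rcases b <;> rcases c <;> rcases a <;> simp at hab ⊢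
      rcases hq : marked q with _ | ⟨n, sq⟩ <;> rcases a <;> rcases b <;> rcases c <;>
        simp at hab <;>
        simp only [shiftMarked, marked_nil, marked_cons_true, marked_cons_false, List.nil_append,
          List.append_nil, List.cons_append, List.head?_nil, List.head?_cons, Option.toList] <;>
        simp only [hq, marked_nil, marked_cons_true, marked_cons_false, List.nil_append]
          at hd hle hmax sub
      · exact knuthEquiv_second hxy hyz
      · have := hle _ (sub [x] (by simp)) (hd.replace (by simp) (by simp [hxy.le]) (by simp))
          (by simp)
        exact ((forall₂_mid this rfl).not_gt hxy).elim
      · have := hmax _ (sub [z, y] (by simp)) (hd.replace (by simpa using hyz) (by simp [hyz.le])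
          (by simp))
        simp at this
      · simp [hq] at hex
      · exact .refl _
      · exact knuthEquiv_second hxy hyz
      · have hny : n < y := by simp [Dec, List.pairwise_append] at hd; tauto
        have hxn : x < n := by
          by_contra hxn
          have := hle _ (sub [x] (by simp)) (hd.replace (by simp) (by simp [hxy.le])
            (by simpa using lt_of_le_of_ne (not_lt.1 hxn) (hne x (by simp) n (by simp [hq]))))
            (by simp)
          exact (forall₂_mid this rfl).not_gt hxy
        exact knuthEquiv_second hxn (hny.trans hyz)
      · have hnz : n < z := by simp [Dec, List.pairwise_append] at hd; tauto
        have hyn : y < n := by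
          by_contra hyn
          have := hmax _ (sub [z, y] (by simp)) (hd.replace (by simpa using hyz)
            (by simp [hyz.le])
            (by simpa using
              ⟨hnz, lt_of_le_of_ne (not_lt.1 hyn) (hne y (by simp) n (by simp [hq]))⟩))
          simp at this
        exact knuthEquiv_second hxy hyn
      · have hny : n < y := by simp [Dec, List.pairwise_append] at hd; tauto
        have hxn : x < n := by
          refine lt_of_le_of_ne ?_ (hne x (by simp) n (by simp [hq])).symm
          simpa [hq] using hex
        exact knuthEquiv_second hxn hny
      · have hnx : n < x := by simp [Dec, List.pairwise_append] at hd; tauto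
        exact knuthEquiv_second (hnx.trans hxy) hyz

theorem exists_marked_of_step {M : List (α × Bool)} {v : List α} (hs : KnuthStep (M.map Prod.fst) v)
    (hn : (M.map Prod.fst).Nodup) (h : IsLeastDec (M.map Prod.fst) (marked M)) :
    ∃ M' : List (α × Bool), M'.map Prod.fst = v ∧ IsLeastDec v (marked M') ∧
      KnuthEquiv (frontShift M) (frontShift M') := by
  generalize hw : M.map Prod.fst = w at *
  cases hs with
  | @first p q x y z hxy hyz =>
    obtain ⟨p, M₁, rfl, rfl, h₁⟩ := List.map_eq_append_iff.1 hw
    obtain ⟨⟨y, b⟩, M₂, rfl, rfl, h₂⟩ := List.map_eq_cons_iff.1 h₁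
    obtain ⟨⟨z, c⟩, M₃, rfl, rfl, h₃⟩ := List.map_eq_cons_iff.1 h₂
    obtain ⟨⟨x, a⟩, q, rfl, rfl, rfl⟩ := List.map_eq_cons_iff.1 h₃
    exact exists_marked_first hxy hyz hn h
  | @second p q x y z hxy hyz =>
    obtain ⟨p, M₁, rfl, rfl, h₁⟩ := List.map_eq_append_iff.1 hw
    obtain ⟨⟨x, a⟩, M₂, rfl, rfl, h₂⟩ := List.map_eq_cons_iff.1 h₁
    obtain ⟨⟨z, c⟩, M₃, rfl, rfl, h₃⟩ := List.map_eq_cons_iff.1 h₂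
    obtain ⟨⟨y, b⟩, q, rfl, rfl, rfl⟩ := List.map_eq_cons_iff.1 h₃
    exact exists_marked_second hxy hyz hn h

open Relation in
theorem exists_marked_of_steps {w v : List α} (hs : ReflTransGen KnuthStep w v) (hn : w.Nodup)
    {M : List (α × Bool)} (hM : M.map Prod.fst = w) (h : IsLeastDec w (marked M)) :
    ∃ M' : List (α × Bool), M'.map Prod.fst = v ∧ IsLeastDec v (marked M') ∧
      KnuthEquiv (frontShift M) (frontShift M') := by
  induction hs using ReflTransGen.head_induction_on generalizing M with
  | refl => exact ⟨M, hM, h, .refl _⟩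
  | head hs _ ih =>
    subst hM
    obtain ⟨M₁, h₁, h₂, h₃⟩ := exists_marked_of_step hs hn h
    obtain ⟨M₂, h₄, h₅, h₆⟩ := ih (hs.perm.nodup_iff.1 hn) h₁ h₂
    exact ⟨M₂, h₄, h₅, h₃.trans _ _ _ h₆⟩

open Relation in
theorem slide_steps {y z : α} (hyz : y < z) {c : List α} (hc : Dec (y :: c)) (r : List α) :
    ReflTransGen KnuthStep (y :: z :: (c ++ r)) (y :: (c ++ z :: r)) := by
  induction c generalizing y with
  | nil => exact .refl
  | cons x c ih =>
    have hxy : x < y := List.rel_of_pairwise_cons hc (by simp)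
    refine .head (.first [] (c ++ r) hxy hyz) ?_
    exact (ih (hxy.trans hyz) (List.pairwise_cons.1 hc).2).lift (y :: ·) fun u v h => by
      simpa using h.context [y] []

open Relation in
theorem column_steps {a c : α} {C : List α} (hC : Dec (c :: C)) (hac : a < c) (ha : a ∉ C)
    (r : List α) : ∃ C' r', ReflTransGen KnuthStep (a :: c :: (C ++ r)) (C' ++ r') ∧
      Dec C' ∧ C'.length = C.length + 1 ∧ ∀ e ∈ C', e ≤ c := by
  induction C generalizing c with
  | nil => exact ⟨[a], c :: r, .refl, by simp, rfl, by simpa using hac.le⟩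
  | cons d C ih =>
    have hdc : d < c := List.rel_of_pairwise_cons hC (by simp)
    rcases lt_trichotomy a d with had | rfl | hda
    · obtain ⟨C', r', h, hC', hl, hle⟩ := ih (List.pairwise_cons.1 hC).2 had (by simp_all)
      refine ⟨c :: C', r', .head (.second [] (C ++ r) had hdc) ?_, ?_, by simp [hl], ?_⟩
      · exact h.lift (c :: ·) fun u v h => by simpa using h.context [c] []
      · exact List.pairwise_cons.2 ⟨fun e he => (hle e he).trans_lt hdc, hC'⟩
      · simpa using fun e he => (hle e he).trans hdc.le
    · simp at ha
    · refine ⟨a :: d :: C, c :: r, .head (.first [] (C ++ r) hda hac) ?_, ?_, by simp, ?_⟩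
      · have := slide_steps hdc (List.pairwise_cons.1 hC).2 r
        exact this.lift (a :: ·) fun u v h => by simpa using h.context [a] []
      · have := (List.pairwise_cons.1 hC).2
        refine List.pairwise_cons.2 ⟨fun e he => ?_, this⟩
        rcases List.mem_cons.1 he with rfl | he
        · exact hda
        · exact (List.rel_of_pairwise_cons this he).trans hda
      · intro e he
        rcases List.mem_cons.1 he with rfl | he
        · exact hac.le
        · exact (List.rel_of_pairwise_cons hC he).le

open Relation in
theorem steps_knuthEquiv {w v : List α} (h : ReflTransGen KnuthStep w v) : KnuthEquiv w v := by
  induction h with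
  | refl => exact .refl _
  | tail _ h ih => exact ih.trans _ _ _ (.rel _ _ h)

open Relation in
theorem steps_perm {w v : List α} (h : ReflTransGen KnuthStep w v) : w.Perm v := by
  induction h with
  | refl => rfl
  | tail _ h ih => exact ih.trans h.perm

open Relation in
theorem steps_dec {w v : List α} (h : ReflTransGen KnuthStep w v) {n : ℕ}
    (hw : ∀ t : List α, t.Sublist w → Dec t → t.length ≤ n) :
    ∀ t : List α, t.Sublist v → Dec t → t.length ≤ n := by
  induction h with
  | refl => exact hw
  | tail _ h ih =>
    intro t ht hd
    obtain ⟨t', ht', hd', hl⟩ := step_dec h ht hd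
    exact hl ▸ ih t' ht' hd'

open Relation in
theorem exists_column_form {w : List α} (hn : w.Nodup) :
    ∃ C r, ReflTransGen KnuthStep w (C ++ r) ∧ Dec C ∧
      ∀ t : List α, t.Sublist (C ++ r) → Dec t → t.length ≤ C.length := by
  induction w with
  | nil => exact ⟨[], [], .refl, by simp, by simp +contextual⟩
  | cons a w ih =>
    obtain ⟨C, r, h, hC, hmax⟩ := ih (List.nodup_cons.1 hn).2
    have h' : ReflTransGen KnuthStep (a :: w) (a :: (C ++ r)) :=
      h.lift (a :: ·) fun u v h => by simpa using h.context [a] []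
    have haw : a ∉ C ++ r := fun ha =>
      (List.nodup_cons.1 hn).1 ((steps_perm h).mem_iff.2 ha)
    by_cases hac : ∀ c ∈ C.head?, c < a
    · refine ⟨a :: C, r, h', ?_, ?_⟩
      · rcases C with _ | ⟨c, C⟩
        · simp
        · exact Dec.glue (a := []) (by simp) hC (hac c (by simp))
      · intro t ht hd
        rcases List.sublist_cons_iff.1 ht with ht | ⟨t, rfl, ht'⟩
        · exact (hmax t ht hd).trans (by simp)
        · simpa using hmax t ht' (List.pairwise_cons.1 hd).2
    · rcases C with _ | ⟨c, C⟩
      · simp at hac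
      · have hac : a < c := lt_of_le_of_ne (by simpa using hac) (by rintro rfl; simp at haw)
        obtain ⟨C', r', h₁, hC', hl, -⟩ := column_steps hC hac (fun h => haw (by simp [h])) r
        refine ⟨C', r', h'.trans h₁, hC', ?_⟩
        rw [hl]
        refine steps_dec h₁ fun t ht hd => ?_
        rcases List.sublist_cons_iff.1 ht with ht | ⟨t, rfl, ht'⟩
        · exact hmax t ht hd
        · by_contra hlt
          rw [not_le] at hlt
          rcases t with _ | ⟨d, t⟩
          · simp at hlt
          · have hda : d < a := List.rel_of_pairwise_cons hd (by simp)
            have hd' := (List.pairwise_cons.1 hd).2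
            have hct := Dec.glue (a := []) (c := c) (by simp) hd' (hda.trans hac)
            rcases List.sublist_cons_iff.1 ht' with h'' | ⟨t', h'', -⟩
            · have := hmax _ (h''.cons_cons c) hct
              simp at hlt this
              omega
            · exact (hda.trans hac).ne (List.cons.inj h'').1

theorem marked_map_true_append {β : Type*} (C r : List β) :
    marked (C.map (·, true) ++ r.map (·, false)) = C := by
  have h₁ : ∀ C : List β, marked (C.map (·, true)) = C := fun C => by
    induction C with
    | nil => rfl
    | cons c C ih => simpa using ih
  have h₂ : ∀ C : List β, marked (C.map (·, false)) = [] := fun C => by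
    induction C with
    | nil => rfl
    | cons c C ih => simpa using ih
  rw [marked_append, h₁, h₂, List.append_nil]

theorem frontShift_prefix {β : Type*} (C r : List β) :
    frontShift (C.map (·, true) ++ r.map (·, false)) = C ++ r := by
  have h₂ : ∀ r n : List β, shiftMarked n (r.map (·, false)) = r := fun r n => by
    induction r with
    | nil => rfl
    | cons c C ih => simpa [shiftMarked] using ih
  have h₃ : ∀ C : List β, marked (C.map (·, true)) = C := fun C => by
    simpa using marked_map_true_append C []
  have h₄ : marked (r.map (·, false)) = [] := by simpa using marked_map_true_append [] r
  have h₁ : ∀ C : List β, C.head?.toList ++ shiftMarked [] (C.map (·, true)) = C := fun C => by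
    induction C with
    | nil => rfl
    | cons c C ih => simpa [shiftMarked, h₃] using ih
  rw [frontShift, marked_map_true_append, shiftMarked_append, h₄, h₂, ← List.append_assoc,
    List.nil_append, h₁]

theorem le_of_column_form {C r t : List α} (pre : List α) (hC : Dec (pre ++ C))
    (hmax : ∀ t : List α, t.Sublist (C ++ r) → Dec (pre ++ t) → t.length ≤ C.length)
    (ht : t.Sublist (C ++ r)) (hd : Dec t) (hl : t.length = C.length) :
    List.Forall₂ (· ≤ ·) C t := by
  induction C generalizing t pre with
  | nil =>
    obtain rfl := List.length_eq_zero_iff.1 hl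
    exact .nil
  | cons c C ih =>
    rcases t with _ | ⟨d, t⟩
    · simp at hl
    refine .cons ?_ ?_
    · by_contra hdc
      rw [not_le] at hdc
      have h₁ : (d :: t).Sublist (C ++ r) := by
        rcases List.sublist_cons_iff.1 ht with h | ⟨_, h, -⟩
        · exact h
        · exact (hdc.ne (List.cons.inj h).1).elim
      have hpc : Dec (pre ++ [c]) := hC.sublist (by simp)
      have := hmax (c :: d :: t) (h₁.cons_cons c) (by simpa using hpc.glue hd hdc)
      simp at this hl
      omega
    · refine ih (pre ++ [c]) (by simpa using hC) (fun u hu hdu => ?_) ?_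
        (List.pairwise_cons.1 hd).2 (by simpa using hl)
      · simpa using hmax (c :: u) (hu.cons_cons c) (by simpa using hdu)
      · exact ht.of_cons_cons

theorem forall₂_antisymm {s t : List α} (h : List.Forall₂ (· ≤ ·) s t)
    (h' : List.Forall₂ (· ≤ ·) t s) : s = t := by
  induction h with
  | nil => rfl
  | cons h _ ih =>
    obtain ⟨h₁, h₂⟩ := List.forall₂_cons.1 h'
    rw [h.antisymm h₁, ih h₂]

theorem eq_of_marked_eq {β : Type*} {M N : List (β × Bool)} (hn : (M.map Prod.fst).Nodup)
    (h : M.map Prod.fst = N.map Prod.fst) (hm : marked M = marked N) : M = N := by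
  have key : ∀ M : List (β × Bool), (M.map Prod.fst).Nodup →
      M = (M.map Prod.fst).map fun a => (a, decide (a ∈ marked M)) := fun M hn => by
    rw [List.map_map]
    refine (List.map_id M).symm.trans (List.map_congr_left fun p hp => ?_)
    obtain ⟨a, b⟩ := p
    have : a ∈ marked M ↔ b = true := by
      simp only [marked, List.mem_map, List.mem_filter]
      refine ⟨?_, fun h => ⟨_, ⟨hp, h⟩, rfl⟩⟩
      rintro ⟨q, ⟨hq, hb⟩, he⟩
      have := List.inj_on_of_nodup_map hn hq hp he
      rw [this] at hb
      exact hb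
    simp [this]
  rw [key M hn, key N (h ▸ hn), h, hm]

/-- Shifting the least longest decreasing subword to the front yields a Knuth equivalent word. -/
theorem frontShift_knuthEquiv {M : List (α × Bool)} (hn : (M.map Prod.fst).Nodup)
    (h : IsLeastDec (M.map Prod.fst) (marked M)) :
    KnuthEquiv (M.map Prod.fst) (frontShift M) := by
  obtain ⟨C, r, hs, hC, hmax⟩ := exists_column_form hn
  obtain ⟨M', hM', h', he⟩ := exists_marked_of_steps hs hn rfl h
  have hl : (marked M').length = C.length :=
    (hmax _ h'.sublist h'.dec).antisymm (h'.length_le C (by simp) hC)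
  have hmC : marked M' = C := forall₂_antisymm (h'.le C (by simp) hC hl.symm)
    (le_of_column_form [] hC hmax h'.sublist h'.dec hl)
  have hM : M' = C.map (·, true) ++ r.map (·, false) := by
    have hn' : (C ++ r).Nodup := (steps_perm hs).nodup_iff.1 hn
    refine eq_of_marked_eq (by rw [hM']; exact hn') (by simp [hM', Function.comp_def]) ?_
    rw [hmC, marked_map_true_append]
  have h₁ : KnuthEquiv (M.map Prod.fst) (C ++ r) := steps_knuthEquiv hs
  rw [hM, frontShift_prefix] at he
  exact h₁.trans _ _ _ (he.symm _ _)
end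

/-- Insertion of an optional value into a tableau. -/
def tabInsertOpt : Option ℕ → List (List ℕ) → List (List ℕ)
  | none, T => T
  | some v, T => tabInsert v T

theorem tabInsert_cons (v : ℕ) (r : List ℕ) (T : List (List ℕ)) :
    tabInsert v (r :: T) = (rowInsert v r).1 :: tabInsertOpt (rowInsert v r).2 T := by
  rw [tabInsert]
  rcases h : rowInsert v r with ⟨r', _ | b⟩ <;> rfl

theorem mem_rowInsert {v w : ℕ} {r : List ℕ} (h : w ∈ (rowInsert v r).1) : w = v ∨ w ∈ r := by
  induction r with
  | nil => simpa [rowInsert] using h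
  | cons a r ih => grind [rowInsert]

theorem pairwise_rowInsert (v : ℕ) {r : List ℕ} (h : r.Pairwise (· ≤ ·)) :
    (rowInsert v r).1.Pairwise (· ≤ ·) := by
  induction r with
  | nil => simp [rowInsert]
  | cons a r ih =>
    have := fun w => @mem_rowInsert v w r
    rw [List.pairwise_cons] at h
    by_cases hv : v < a <;> simp only [rowInsert, hv, if_true, if_false, List.pairwise_cons] <;> grind

theorem rows_tabInsert (v : ℕ) {T : List (List ℕ)} (h : ∀ r ∈ T, r.Pairwise (· ≤ ·)) :
    ∀ r ∈ tabInsert v T, r.Pairwise (· ≤ ·) := by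
  induction T generalizing v with
  | nil => simp [tabInsert]
  | cons a T ih =>
    rw [tabInsert_cons]
    have := pairwise_rowInsert v (h a (by simp))
    rcases h' : (rowInsert v a).2 with _ | b <;> grind [tabInsertOpt]

theorem lt_of_rowInsert_eq_some {v b : ℕ} {r : List ℕ} (h : (rowInsert v r).2 = some b) :
    v < b ∧ b ∈ r := by
  induction r with
  | nil => simp [rowInsert] at h
  | cons a r ih => grind [rowInsert]

theorem rowInsert_first {x y z : ℕ} (hxy : x < y) (hyz : y ≤ z) {r : List ℕ}
    (h : r.Pairwise (· ≤ ·)) :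
    (rowInsert x (rowInsert z (rowInsert y r).1).1).1 =
        (rowInsert z (rowInsert x (rowInsert y r).1).1).1 ∧
      (rowInsert x (rowInsert z (rowInsert y r).1).1).2 = (rowInsert x (rowInsert y r).1).2 ∧
      (rowInsert z (rowInsert x (rowInsert y r).1).1).2 = (rowInsert z (rowInsert y r).1).2 ∧
      ∃ x', (rowInsert x (rowInsert y r).1).2 = some x' ∧ x' ≤ y ∧
        ((rowInsert y r).2 = none → (rowInsert z (rowInsert y r).1).2 = none) ∧
        ∀ z', (rowInsert z (rowInsert y r).1).2 = some z' →
          ∃ y', (rowInsert y r).2 = some y' ∧ x' < y' ∧ y' ≤ z' := by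
  have hzy : ¬ z < y := by omega
  have hzx : ¬ z < x := by omega
  induction r with
  | nil => simp [rowInsert, hxy, hzy, hzx]
  | cons c r ih =>
    rw [List.pairwise_cons] at h
    obtain ⟨h₁, h₂, h₃, x', hx', hxy', hn, hs⟩ := ih h.2
    by_cases hx : x < c
    · by_cases hy : y < c
      · simp only [rowInsert, hy, hxy, hzy, hzx, if_true, if_false]
        refine ⟨trivial, trivial, trivial, y, rfl, le_rfl, by simp, fun z' hz' => ⟨c, rfl, hy, ?_⟩⟩
        exact h.1 _ (lt_of_rowInsert_eq_some hz').2
      · have hz : ¬ z < c := by omega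
        simp only [rowInsert, hx, hy, hz, hzx, if_true, if_false]
        refine ⟨trivial, trivial, trivial, c, rfl, by omega, hn, fun z' hz' => ?_⟩
        obtain ⟨y', hy', -, h'⟩ := hs z' hz'
        exact ⟨y', hy', by have := (lt_of_rowInsert_eq_some hy').1; omega, h'⟩
    · have hy : ¬ y < c := by omega
      have hz : ¬ z < c := by omega
      simp only [rowInsert, hx, hy, hz, if_false, List.cons.injEq, true_and]
      exact ⟨h₁, h₂, h₃, x', hx', hxy', hn, hs⟩

theorem exists_rowInsert_eq_some {y z : ℕ} (hyz : y < z) (r : List ℕ) :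
    ∃ y', (rowInsert y (rowInsert z r).1).2 = some y' ∧ y' ≤ z := by
  induction r with
  | nil => simp [rowInsert, hyz]
  | cons c r ih =>
    by_cases hz : z < c
    · simp [rowInsert, hz, hyz]
    · by_cases hy : y < c
      · simp only [rowInsert, hz, hy, if_true, if_false, Option.some.injEq, exists_eq_left']
        omega
      · simpa only [rowInsert, hz, hy, if_false] using ih

theorem rowInsert_second {x y z : ℕ} (hxy : x ≤ y) (hyz : y < z) {r : List ℕ}
    (h : r.Pairwise (· ≤ ·)) :
    (rowInsert y (rowInsert z (rowInsert x r).1).1).1 =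
        (rowInsert y (rowInsert x (rowInsert z r).1).1).1 ∧
      (((rowInsert x r).2 = (rowInsert x (rowInsert z r).1).2 ∧
        (rowInsert z (rowInsert x r).1).2 = (rowInsert z r).2 ∧
        (rowInsert y (rowInsert z (rowInsert x r).1).1).2 =
          (rowInsert y (rowInsert x (rowInsert z r).1).1).2 ∧
        ∀ z', (rowInsert z r).2 = some z' →
          ∃ x' y', (rowInsert x r).2 = some x' ∧
            (rowInsert y (rowInsert x (rowInsert z r).1).1).2 = some y' ∧ x' ≤ y' ∧ y' < z') ∨
       ((rowInsert x r).2 = (rowInsert z r).2 ∧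
        (rowInsert z (rowInsert x r).1).2 = (rowInsert y (rowInsert x (rowInsert z r).1).1).2 ∧
        (rowInsert y (rowInsert z (rowInsert x r).1).1).2 = some z ∧
        (rowInsert x (rowInsert z r).1).2 = some z ∧
        ∀ z', (rowInsert z (rowInsert x r).1).2 = some z' →
          ∃ x', (rowInsert x r).2 = some x' ∧ z < x' ∧ x' ≤ z')) := by
  have hyx : ¬ y < x := by omega
  have hzx : ¬ z < x := by omega
  have hxz : x < z := by omega
  induction r with
  | nil => simp [rowInsert, hyx, hzx, hxz, hyz]
  | cons c r ih =>
    rw [List.pairwise_cons] at h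
    by_cases hz : z < c
    · have hx : x < c := by omega
      simp only [rowInsert, hx, hz, hyx, hzx, hxz, if_true, if_false]
      rcases r with _ | ⟨d, r⟩
      · simp [rowInsert, hyz]
      · have hcd := h.1 d (by simp)
        have hzd : z < d := by omega
        have hyd : y < d := by omega
        simp only [rowInsert, hzd, hyz, hyd, if_true]
        refine ⟨trivial, .inr ⟨trivial, trivial, trivial, trivial, ?_⟩⟩
        rintro _ ⟨⟩
        exact ⟨c, rfl, hz, hcd⟩
    · by_cases hx : x < c
      · simp only [rowInsert, hx, hz, hyx, hzx, if_true, if_false]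
        refine ⟨trivial, .inl ⟨trivial, trivial, trivial, fun z' hz' => ?_⟩⟩
        obtain ⟨y', hy', hyz'⟩ := exists_rowInsert_eq_some hyz r
        refine ⟨c, y', rfl, hy', ?_, hyz'.trans_lt (lt_of_rowInsert_eq_some hz').1⟩
        rcases mem_rowInsert (lt_of_rowInsert_eq_some hy').2 with rfl | h'
        · omega
        · exact h.1 _ h'
      · have hy : ¬ y < c := by omega
        simp only [rowInsert, hx, hy, hz, if_false, List.cons.injEq, true_and]
        exact ih h.2

/-- Successive insertion of the letters of a word into a tableau. -/
def insWord (T : List (List ℕ)) (w : List ℕ) : List (List ℕ) :=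
  w.foldl (fun T v => tabInsert v T) T

theorem insWord_triple {T : List (List ℕ)} (hT : ∀ r ∈ T, r.Pairwise (· ≤ ·)) :
    (∀ x y z : ℕ, x < y → y ≤ z → insWord T [y, z, x] = insWord T [y, x, z]) ∧
      ∀ x y z : ℕ, x ≤ y → y < z → insWord T [x, z, y] = insWord T [z, x, y] := by
  induction T with
  | nil =>
    constructor
    · intro x y z hxy hyz
      have hzy : ¬ z < y := by omega
      have hzx : ¬ z < x := by omega
      simp [insWord, tabInsert, rowInsert, hxy, hzy, hzx]
    · intro x y z hxy hyz
      have hyx : ¬ y < x := by omega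
      have hzx : ¬ z < x := by omega
      have hxz : x < z := by omega
      simp [insWord, tabInsert, rowInsert, hyz, hyx, hzx, hxz]
  | cons r T ih =>
    have hr := hT r (by simp)
    obtain ⟨ih₁, ih₂⟩ := ih fun r h => hT r (by simp [h])
    simp only [insWord, List.foldl_cons, List.foldl_nil] at ih₁ ih₂ ⊢
    constructor
    · intro x y z hxy hyz
      obtain ⟨h, h₁, h₂, x', hx', -, hn, hs⟩ := rowInsert_first hxy hyz hr
      simp only [tabInsert_cons, h, h₁, h₂, hx', List.cons.injEq, true_and]
      rcases hz : (rowInsert z (rowInsert y r).1).2 with _ | z'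
      · rfl
      · obtain ⟨y', hy', h₃, h₄⟩ := hs z' hz
        simpa only [hy', tabInsertOpt] using ih₁ x' y' z' h₃ h₄
    · intro x y z hxy hyz
      obtain ⟨h, ⟨h₁, h₂, h₃, hs⟩ | ⟨h₁, h₂, h₃, h₄, hs⟩⟩ := rowInsert_second hxy hyz hr
      · simp only [tabInsert_cons, h, h₁, h₂, h₃, List.cons.injEq, true_and]
        rcases hz : (rowInsert z r).2 with _ | z'
        · rfl
        · obtain ⟨x', y', hx', hy', h₄, h₅⟩ := hs z' hz
          rw [h₁] at hx'
          simpa only [hx', hy', tabInsertOpt] using ih₂ x' y' z' h₄ h₅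
      · simp only [tabInsert_cons, h, ← h₁, ← h₂, h₃, h₄, List.cons.injEq, true_and]
        rcases hz : (rowInsert z (rowInsert x r).1).2 with _ | z'
        · rfl
        · obtain ⟨x', hx', h₅, h₆⟩ := hs z' hz
          simpa only [hx', tabInsertOpt] using ih₁ z x' z' h₅ h₆

theorem insWord_append (T : List (List ℕ)) (w v : List ℕ) :
    insWord T (w ++ v) = insWord (insWord T w) v := List.foldl_append

theorem rows_insWord {T : List (List ℕ)} (h : ∀ r ∈ T, r.Pairwise (· ≤ ·)) (w : List ℕ) :
    ∀ r ∈ insWord T w, r.Pairwise (· ≤ ·) := by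
  induction w generalizing T with
  | nil => exact h
  | cons v w ih => exact ih (rows_tabInsert v h)

theorem KnuthStep.insWord_eq {w v : List ℕ} (h : KnuthStep w v) : insWord [] w = insWord [] v := by
  cases h with
  | @first p q x y z hxy hyz =>
    have := (insWord_triple (rows_insWord (T := []) (by simp) p)).1 x y z hxy hyz.le
    simp only [insWord_append _ p]
    rw [show y :: z :: x :: q = [y, z, x] ++ q from rfl, insWord_append, this]
    rfl
  | @second p q x y z hxy hyz =>
    have := (insWord_triple (rows_insWord (T := []) (by simp) p)).2 x y z hxy.le hyz
    simp only [insWord_append _ p]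
    rw [show x :: z :: y :: q = [x, z, y] ++ q from rfl, insWord_append, this]
    rfl

theorem KnuthEquiv.reverse {α : Type*} [LinearOrder α] {w v : List α} (h : KnuthEquiv w v) :
    KnuthEquiv w.reverse v.reverse := by
  induction h with
  | rel _ _ h =>
    refine .rel _ _ ?_
    cases h with
    | first p q hxy hyz => simpa using KnuthStep.second q.reverse p.reverse hxy hyz
    | second p q hxy hyz => simpa using KnuthStep.first q.reverse p.reverse hxy hyz
  | refl => exact .refl _
  | symm _ _ _ ih => exact ih.symm
  | trans _ _ _ _ _ ih ih' => exact ih.trans _ _ _ ih'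

open OrderDual in
theorem KnuthEquiv.ofDual {α : Type*} [LinearOrder α] {w v : List αᵒᵈ} (h : KnuthEquiv w v) :
    KnuthEquiv (w.map ofDual) (v.map ofDual) := by
  induction h with
  | rel _ _ h =>
    refine .symm _ _ (.rel _ _ ?_)
    cases h with
    | first p q hxy hyz =>
      simpa using KnuthStep.first (p.map OrderDual.ofDual) (q.map OrderDual.ofDual)
        (ofDual_lt_ofDual.2 hyz) (ofDual_lt_ofDual.2 hxy)
    | second p q hxy hyz =>
      simpa using KnuthStep.second (p.map OrderDual.ofDual) (q.map OrderDual.ofDual)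
        (ofDual_lt_ofDual.2 hyz) (ofDual_lt_ofDual.2 hxy)
  | refl => exact .refl _
  | symm _ _ _ ih => exact ih.symm
  | trans _ _ _ _ _ ih ih' => exact ih.trans _ _ _ ih'

theorem KnuthEquiv.insWord_eq {w v : List ℕ} (h : KnuthEquiv w v) :
    insWord [] w = insWord [] v := by
  induction h with
  | rel _ _ h => exact h.insWord_eq
  | refl => rfl
  | symm _ _ _ ih => exact ih.symm
  | trans _ _ _ _ _ ih ih' => exact ih.trans ih'

/-- `L` lists the cells of the rook placement `P` by increasing column. -/
structure IsListing (L : List Cell) (P : Finset Cell) : Prop where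
  sorted : L.Pairwise (·.1 < ·.1)
  nodup : (L.map Prod.snd).Nodup
  mem_iff : ∀ p, p ∈ L ↔ p ∈ P

theorem insTab_eq_insWord (P : Finset Cell) :
    insTab P = insWord [] ((rsSteps P).map Prod.snd) := by
  have h : ∀ (l : List (ℕ × ℕ)) (T R : List (List ℕ)),
      (l.foldl (fun TR cv =>
        let T' := tabInsert cv.2 TR.1
        (T', placeAt cv.1 (diffRow TR.1 T') TR.2)) (T, R)).1 = insWord T (l.map Prod.snd) := by
    intro l
    induction l with
    | nil => intros; rfl
    | cons p l ih => intro T R; exact ih _ _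
  exact h _ _ _

theorem rowAt_eq {P : Finset Cell} (h : ∀ p ∈ P, ∀ q ∈ P, p.1 = q.1 → p = q) {p : Cell}
    (hp : p ∈ P) : rowAt P p.1 = p.2 := by
  have : {r | (p.1, r) ∈ P} = {p.2} := by
    ext r
    refine ⟨fun hr => congrArg Prod.snd (h _ hr _ hp rfl), ?_⟩
    rintro rfl
    exact hp
  rw [rowAt, this, csSup_singleton]

theorem isListing_rsSteps {F P : Finset Cell} (h : IsPlacement F P) : IsListing (rsSteps P) P := by
  have hmem : ∀ p, p ∈ rsSteps P ↔ p ∈ P := by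
    intro p
    simp only [rsSteps, List.mem_map, Finset.mem_sort, Finset.mem_image]
    constructor
    · rintro ⟨_, ⟨q, hq, rfl⟩, rfl⟩
      rwa [rowAt_eq h.2.1 hq]
    · exact fun hp => ⟨p.1, ⟨p, hp, rfl⟩, by rw [rowAt_eq h.2.1 hp]⟩
  have hs : (rsSteps P).Pairwise (·.1 < ·.1) :=
    List.pairwise_map.2 (Finset.sortedLT_sort (P.image Prod.fst)).pairwise
  refine ⟨hs, ?_, hmem⟩
  refine List.Nodup.map_on (fun p hp q hq he => h.2.2 p ((hmem p).1 hp) q ((hmem q).1 hq) he) ?_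
  exact hs.imp fun h he => h.ne (congrArg Prod.fst he)

theorem IsListing.rsSteps_eq {L : List Cell} {P : Finset Cell} (h : IsListing L P) :
    rsSteps P = L := by
  have hs : (L.map Prod.fst).Pairwise (· < ·) := List.pairwise_map.2 h.sorted
  have h₁ : (P.image Prod.fst).sort (· ≤ ·) = L.map Prod.fst := by
    have : P.image Prod.fst = (L.map Prod.fst).toFinset := by
      ext c
      simp [h.mem_iff]
    rw [this]
    exact (List.toFinset_sort _ (hs.imp ne_of_lt)).2 (hs.imp le_of_lt)
  rw [rsSteps, h₁, List.map_map]
  refine (List.map_congr_left fun p hp => ?_).trans (List.map_id L)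
  have : rowAt P p.1 = p.2 := rowAt_eq (fun p hp q hq he => List.inj_on_of_nodup_map
    (hs.imp ne_of_lt) ((h.mem_iff p).2 hp) ((h.mem_iff q).2 hq) he) ((h.mem_iff p).1 hp)
  exact Prod.ext rfl this

theorem IsListing.insTab_eq {L : List Cell} {P : Finset Cell} (h : IsListing L P) :
    insTab P = insWord [] (L.map Prod.snd) := by
  rw [insTab_eq_insWord, h.rsSteps_eq]

section
variable {γ κ α : Type*} [LinearOrder κ] [LinearOrder α]

/-- A sequence of elements of `W` along which `c` increases and `f` decreases. -/
def IsDecSeqOn (c : γ → κ) (f : γ → α) (W : Set γ) (k : ℕ) (S : Fin k → γ) : Prop :=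
  (∀ i, S i ∈ W) ∧ ∀ i j : Fin k, i < j → c (S i) < c (S j) ∧ f (S j) < f (S i)

variable {c : γ → κ} {f : γ → α} {W : Set γ} {k : ℕ} {S T : Fin k → γ}

/-- An exchange argument: otherwise an initial part of `T` followed by a final part of `S`
would be too long. -/
theorem IsDecSeqOn.le_of_le (hf : Set.InjOn f W) (hS : IsDecSeqOn c f W k S)
    (hT : IsDecSeqOn c f W k T) (hmax : ∀ l (U : Fin l → γ), IsDecSeqOn c f W l U → l ≤ k)
    {i : Fin k} (h : f (S i) ≤ f (T i)) : c (S i) ≤ c (T i) := by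
  by_contra hlt
  rw [not_le] at hlt
  have h : f (S i) < f (T i) := h.lt_of_ne fun he => hlt.ne (by rw [hf (hS.1 i) (hT.1 i) he])
  have hTi : ∀ n : Fin k, n ≤ i → c (T n) ≤ c (T i) ∧ f (T i) ≤ f (T n) := fun n hn => by
    rcases hn.eq_or_lt with rfl | hn
    · exact ⟨le_rfl, le_rfl⟩
    · exact ⟨(hT.2 _ _ hn).1.le, (hT.2 _ _ hn).2.le⟩
  have hSi : ∀ n : Fin k, i ≤ n → c (S i) ≤ c (S n) ∧ f (S n) ≤ f (S i) := fun n hn => by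
    rcases hn.eq_or_lt with rfl | hn
    · exact ⟨le_rfl, le_rfl⟩
    · exact ⟨(hS.2 _ _ hn).1.le, (hS.2 _ _ hn).2.le⟩
  have hU : IsDecSeqOn c f W (k + 1) fun n : Fin (k + 1) =>
      if h : n.1 ≤ i.1 then T ⟨n.1, by omega⟩ else S ⟨n.1 - 1, by omega⟩ := by
    refine ⟨fun n => ?_, fun n m hnm => ?_⟩
    · dsimp only
      split_ifs
      · exact hT.1 _
      · exact hS.1 _
    · have hnm' : n.1 < m.1 := hnm
      dsimp only
      split_ifs with h₁ h₂ h₂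
      · exact hT.2 _ _ hnm
      · have h₃ := hTi ⟨n.1, by omega⟩ h₁
        have h₄ := hSi ⟨m.1 - 1, by omega⟩ (Fin.le_def.2 (by dsimp only; omega))
        exact ⟨h₃.1.trans_lt (hlt.trans_le h₄.1), h₄.2.trans_lt (h.trans_le h₃.2)⟩
      · omega
      · exact hS.2 _ _ (Fin.lt_def.2 (by dsimp only; omega))
  exact absurd (hmax _ _ hU) (by omega)

/-- A longest sequence that is minimal with respect to entrywise comparison is least. -/
theorem IsDecSeqOn.le_of_minimal (hf : Set.InjOn f W) (hS : IsDecSeqOn c f W k S)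
    (hmax : ∀ l (U : Fin l → γ), IsDecSeqOn c f W l U → l ≤ k)
    (hmin : ∀ T, IsDecSeqOn c f W k T → (∀ i, f (T i) ≤ f (S i)) → ∀ i, f (T i) = f (S i))
    (hT : IsDecSeqOn c f W k T) (i : Fin k) : f (S i) ≤ f (T i) := by
  have hU : IsDecSeqOn c f W k fun i => if f (S i) ≤ f (T i) then S i else T i := by
    refine ⟨fun i => ?_, fun i j hij => ?_⟩
    · dsimp only
      split_ifs
      · exact hS.1 _
      · exact hT.1 _
    · have h₁ := hS.2 _ _ hij
      have h₂ := hT.2 _ _ hij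
      dsimp only
      split_ifs with hi hj hj
      · exact h₁
      · exact ⟨(hS.le_of_le hf hT hmax hi).trans_lt h₂.1, (not_le.1 hj).trans h₁.2⟩
      · rw [not_le] at hi
        exact ⟨(hT.le_of_le hf hS hmax hi.le).trans_lt h₁.1, hj.trans_lt h₂.2⟩
      · exact h₂
  have := hmin _ hU (fun i => by split_ifs with h; exacts [le_rfl, (not_le.1 h).le]) i
  by_contra h
  simp only [h, if_false] at this
  exact h this.ge

/-- A set of positions of `w` listed in order is a sublist. -/
theorem sublist_of_pairwise_of_subset {s w : List γ} (hw : w.Pairwise (c · < c ·))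
    (hs : s.Pairwise (c · < c ·)) (h : s ⊆ w) : s.Sublist w := by
  induction w generalizing s with
  | nil => rw [List.subset_nil.1 h]
  | cons a w ih =>
    rcases s with _ | ⟨b, s⟩
    · exact List.nil_sublist _
    · have h₁ := List.pairwise_cons.1 hs
      have h₂ := List.pairwise_cons.1 hw
      have key : ∀ x ∈ s, x ∈ w := fun x hx => by
        rcases List.mem_cons.1 (h (List.mem_cons_of_mem _ hx)) with rfl | h₃
        · rcases List.mem_cons.1 (h (List.mem_cons_self)) with rfl | h₄
          · exact absurd (h₁.1 _ hx) (lt_irrefl _)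
          · exact absurd (h₁.1 _ hx) (h₂.1 _ h₄).asymm
        · exact h₃
      rcases List.mem_cons.1 (h (List.mem_cons_self)) with rfl | h₃
      · exact (ih h₂.2 h₁.2 key).cons_cons _
      · exact (ih h₂.2 hs (List.cons_subset.2 ⟨h₃, key⟩)).cons _

theorem IsDecSeqOn.isLeastDec {w : List γ} (hw : w.Pairwise (c · < c ·)) (hn : (w.map f).Nodup)
    (hS : IsDecSeqOn c f {x | x ∈ w} k S)
    (hmax : ∀ l (U : Fin l → γ), IsDecSeqOn c f {x | x ∈ w} l U → l ≤ k)
    (hmin : ∀ T, IsDecSeqOn c f {x | x ∈ w} k T → (∀ i, f (T i) ≤ f (S i)) →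
      ∀ i, f (T i) = f (S i)) :
    (List.ofFn S).Sublist w ∧ IsLeastDec (w.map f) ((List.ofFn S).map f) := by
  have hf : Set.InjOn f {x | x ∈ w} := fun x hx y hy h => List.inj_on_of_nodup_map hn hx hy h
  have hsub : (List.ofFn S).Sublist w := by
    refine sublist_of_pairwise_of_subset hw (List.pairwise_ofFn.2 fun i j h => (hS.2 i j h).1) ?_
    intro x hx
    obtain ⟨i, rfl⟩ := List.mem_ofFn.1 hx
    exact hS.1 i
  have key : ∀ t : List α, t.Sublist (w.map f) → Dec t →
      ∃ u : List γ, t = u.map f ∧ IsDecSeqOn c f {x | x ∈ w} u.length u.get := by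
    intro t ht hd
    obtain ⟨u, hu, rfl⟩ := List.sublist_map_iff.1 ht
    refine ⟨u, rfl, fun i => hu.subset (u.get_mem i), fun i j h => ⟨?_, ?_⟩⟩
    · exact List.pairwise_iff_get.1 (hw.sublist hu) i j h
    · exact List.pairwise_iff_get.1 (List.pairwise_map.1 hd) i j h
  refine ⟨hsub, hsub.map f, List.pairwise_map.2 (List.pairwise_ofFn.2 fun i j h =>
    (hS.2 i j h).2), fun t ht hd => ?_, fun t ht hd hl => ?_⟩
  · obtain ⟨u, rfl, hu⟩ := key t ht hd
    simpa using hmax _ _ hu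
  · obtain ⟨u, rfl, hu⟩ := key t ht hd
    have hl : u.length = k := by simpa using hl
    subst hl
    have := fun i => hS.le_of_minimal hf hmax hmin hu i
    rw [List.forall₂_iff_get]
    refine ⟨by simp, fun i h₁ h₂ => ?_⟩
    simpa using this ⟨i, by simpa using h₂⟩
end

theorem marked_map {β δ : Type*} (f : β → δ) (M : List (β × Bool)) :
    marked (M.map (Prod.map f id)) = (marked M).map f := by
  induction M with
  | nil => rfl
  | cons p M ih => rcases p with ⟨p, _ | _⟩ <;> simpa using ih

theorem marked_map_decide {β : Type*} {D w : List β} (h : D.Sublist w) (hw : w.Nodup) :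
    marked (w.map fun p => (p, decide (p ∈ D))) = D := by
  induction h with
  | slnil => rfl
  | @cons D w a h ih =>
    obtain ⟨h₁, h₂⟩ := List.nodup_cons.1 hw
    have : a ∉ D := fun ha => h₁ (h.subset ha)
    simpa [this] using ih h₂
  | @cons_cons D w a h ih =>
    obtain ⟨h₁, h₂⟩ := List.nodup_cons.1 hw
    rw [List.map_cons]
    simp only [List.mem_cons_self, decide_true, marked_cons_true, List.cons.injEq, true_and]
    refine Eq.trans (congrArg marked (List.map_congr_left fun p hp => ?_)) (ih h₂)
    have : p ≠ a := by rintro rfl; exact h₁ hp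
    simp [this]

/-- Each marked cell keeps its column and takes the row of the next marked cell; the last marked
cell disappears. -/
def cellShift : List (Cell × Bool) → List Cell
  | [] => []
  | (p, false) :: M => p :: cellShift M
  | (p, true) :: M => (marked M).head?.toList.map (fun q => (p.1, q.2)) ++ cellShift M

theorem cellShift_map {β : Type*} (g : ℕ → β) (M : List (Cell × Bool)) :
    (cellShift M).map (fun p => g p.2) = shiftMarked [] (M.map (Prod.map (fun p => g p.2) id)) := by
  induction M with
  | nil => rfl
  | cons p M ih =>
    rcases p with ⟨p, _ | _⟩
    · simpa [cellShift, shiftMarked] using ih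
    · simp only [cellShift, List.map_append, List.map_cons, Prod.map, id, shiftMarked,
        List.append_nil, ih]
      congr 1
      have := marked_map (fun p : Cell => g p.2) M
      rw [this]
      rcases marked M with _ | ⟨q, D⟩ <;> simp

theorem cellShift_fst_sublist (M : List (Cell × Bool)) :
    ((cellShift M).map Prod.fst).Sublist (M.map fun p => p.1.1) := by
  induction M with
  | nil => exact .refl _
  | cons p M ih =>
    rcases p with ⟨p, _ | _⟩
    · simpa [cellShift] using ih
    · rcases h : marked M with _ | ⟨q, D⟩
      · simpa [cellShift, h] using ih.cons p.1
      · simpa [cellShift, h] using ih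

theorem mem_cellShift {M : List (Cell × Bool)} {p : Cell} :
    p ∈ cellShift M ↔ (p, false) ∈ M ∨
      p ∈ List.zipWith (fun q q' : Cell => (q.1, q'.2)) (marked M) (marked M).tail := by
  induction M with
  | nil => simp [cellShift]
  | cons q M ih =>
    rcases q with ⟨q, _ | _⟩
    · simp [cellShift, ih, or_assoc]
    · rcases h : marked M with _ | ⟨q', D⟩
      · simp [cellShift, ih, h]
      · simp [cellShift, ih, h]
        tauto

theorem zipWith_ofFn (a : ℕ) {k : ℕ} (S : Fin k → Cell) :
    List.zipWith (fun q q' : Cell => (q.1, q'.2)) ((a, 0) :: List.ofFn S) (List.ofFn S) =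
      List.ofFn (shiftLSeq a k S) := by
  refine List.ext_getElem (by simp) fun i h₁ h₂ => ?_
  rcases i with _ | i
  · simp [shiftLSeq]
  · simp [shiftLSeq]

/-- Left shift of a least longest decreasing sequence, in terms of listings; `c` and `g` are used
to reverse the order of the columns or rows. -/
theorem exists_shift {κ α : Type*} [LinearOrder κ] [LinearOrder α] (c : ℕ → κ) (g : ℕ → α)
    (hg : Function.Injective g) {a k : ℕ} {w : List Cell} {S : Fin k → Cell}
    (ha : ∀ p ∈ w, c a < c p.1) (hw : w.Pairwise (c ·.1 < c ·.1))
    (hn : (w.map Prod.snd).Nodup)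
    (hS : IsDecSeqOn (fun p : Cell => c p.1) (fun p : Cell => g p.2) {x | x ∈ w} k S)
    (hmax : ∀ l (U : Fin l → Cell),
      IsDecSeqOn (fun p : Cell => c p.1) (fun p : Cell => g p.2) {x | x ∈ w} l U → l ≤ k)
    (hmin : ∀ T, IsDecSeqOn (fun p : Cell => c p.1) (fun p : Cell => g p.2) {x | x ∈ w} k T →
      (∀ i, g (T i).2 ≤ g (S i).2) → ∀ i, g (T i).2 = g (S i).2) :
    ∃ v : List Cell, v.Pairwise (c ·.1 < c ·.1) ∧ (∀ p ∈ v, p.1 = a ∨ ∃ q ∈ w, p.1 = q.1) ∧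
      (∀ p, p ∈ v ↔ (p ∈ w ∧ ∀ i, S i ≠ p) ∨ ∃ i, shiftLSeq a k S i = p) ∧
      KnuthEquiv (w.map fun p => g p.2) (v.map fun p => g p.2) := by
  have hn' : (w.map fun p => g p.2).Nodup := by
    simpa [Function.comp_def] using hn.map hg
  obtain ⟨hsub, hd⟩ := hS.isLeastDec hw hn' hmax hmin
  set M : List (Cell × Bool) := w.map fun p => (p, decide (p ∈ List.ofFn S)) with hM
  have hmM : marked M = List.ofFn S := by
    rw [hM]
    convert marked_map_decide hsub (hn'.of_map _)
  have hcol := cellShift_fst_sublist (((a, 0), true) :: M)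
  have hMfst : M.map (fun p => p.1.1) = w.map Prod.fst := by simp [hM, Function.comp_def]
  rw [List.map_cons, hMfst] at hcol
  refine ⟨cellShift (((a, 0), true) :: M), ?_, ?_, ?_, ?_⟩
  · have : (a :: w.map Prod.fst).Pairwise (c · < c ·) :=
      List.pairwise_cons.2 ⟨by simpa using ha, List.pairwise_map.2 hw⟩
    exact (List.pairwise_map (f := Prod.fst) (R := (c · < c ·))).1 (this.sublist hcol)
  · intro p hp
    rcases List.mem_cons.1 (hcol.subset (List.mem_map_of_mem hp)) with h | h
    · exact .inl h
    · obtain ⟨q, hq, he⟩ := List.mem_map.1 h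
      exact .inr ⟨q, hq, he.symm⟩
  · intro p
    rw [mem_cellShift, marked_cons_true, hmM, List.tail_cons, zipWith_ofFn, List.mem_ofFn]
    refine or_congr_left ⟨fun h => ?_, fun h => List.mem_cons_of_mem _ (List.mem_map.2
      ⟨p, h.1, by simpa using h.2⟩)⟩
    obtain ⟨q, hq, he⟩ := List.mem_map.1 ((List.mem_cons.1 h).resolve_left (by simp))
    obtain ⟨rfl, he⟩ := Prod.ext_iff.1 he
    exact ⟨hq, by simpa using he⟩
  · have h₁ : (M.map (Prod.map (fun p => g p.2) id)).map Prod.fst = w.map fun p => g p.2 := by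
      simp [hM, Function.comp_def]
    have := frontShift_knuthEquiv (M := M.map (Prod.map (fun p => g p.2) id)) (h₁ ▸ hn')
      (by rw [h₁, marked_map, hmM]; exact hd)
    rw [h₁] at this
    rw [cellShift_map]
    simpa [shiftMarked, frontShift] using this

theorem IsListing.splice {L v : List Cell} {P Q : Finset Cell} {a b : ℕ} (h : IsListing L P)
    (hab : a ≤ b) (hv : v.Pairwise (·.1 < ·.1)) (hvab : ∀ p ∈ v, a ≤ p.1 ∧ p.1 ≤ b)
    (hk : KnuthEquiv ((L.filter fun p => a ≤ p.1 ∧ p.1 ≤ b).map Prod.snd) (v.map Prod.snd))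
    (hQ : ∀ p, p ∈ Q ↔ (p ∈ P ∧ ¬(a ≤ p.1 ∧ p.1 ≤ b)) ∨ p ∈ v) :
    ∃ L', IsListing L' Q ∧ KnuthEquiv (L.map Prod.snd) (L'.map Prod.snd) := by
  have hsort : ∀ u : List Cell, u.Pairwise (·.1 < ·.1) → (∀ p ∈ u, a ≤ p.1 ∧ p.1 ≤ b) →
      ((L.filter fun p => p.1 < a) ++ u ++ L.filter fun p => b < p.1).Pairwise (·.1 < ·.1) := by
    intro u hu hab'
    rw [List.pairwise_append, List.pairwise_append]
    refine ⟨⟨h.sorted.filter _, hu, fun p hp q hq => ?_⟩, h.sorted.filter _, fun p hp q hq => ?_⟩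
    · have := (List.mem_filter.1 hp).2
      have h₂ := hab' q hq
      simp only [decide_eq_true_eq] at this
      omega
    · have := (List.mem_filter.1 hq).2
      simp only [decide_eq_true_eq] at this
      rcases List.mem_append.1 hp with hp | hp
      · have h₂ := (List.mem_filter.1 hp).2
        simp only [decide_eq_true_eq] at h₂
        omega
      · have h₂ := hab' p hp
        omega
  have hL : L = (L.filter fun p => p.1 < a) ++ (L.filter fun p => a ≤ p.1 ∧ p.1 ≤ b) ++
      L.filter fun p => b < p.1 := by
    have hs := hsort _ (h.sorted.filter _) fun p hp =>
      of_decide_eq_true (List.mem_filter.1 hp).2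
    refine (sublist_of_pairwise_of_subset hs h.sorted fun p hp => ?_).antisymm
      (sublist_of_pairwise_of_subset h.sorted hs fun p hp => ?_)
    · simp only [List.mem_append, List.mem_filter, hp, decide_eq_true_eq, true_and]
      omega
    · simp only [List.mem_append, List.mem_filter] at hp
      tauto
  have hk' := hk.context ((L.filter fun p => p.1 < a).map Prod.snd)
    ((L.filter fun p => b < p.1).map Prod.snd)
  simp only [← List.map_append] at hk'
  rw [← hL] at hk'
  refine ⟨_, ⟨hsort v hv hvab, hk'.perm.nodup_iff.1 h.nodup, fun p => ?_⟩, hk'⟩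
  simp only [hQ, List.mem_append, List.mem_filter, h.mem_iff, decide_eq_true_eq]
  have : p.1 < a ∨ b < p.1 ↔ ¬(a ≤ p.1 ∧ p.1 ≤ b) := by omega
  rw [← this]
  tauto

theorem mem_leftShift {a k : ℕ} {S : Fin k → Cell} {P : Finset Cell} {p : Cell} :
    p ∈ leftShift a k S P ↔ (p ∈ P ∧ ∀ i, S i ≠ p) ∨ ∃ i, shiftLSeq a k S i = p := by
  simp [leftShift]

theorem rightShift_eq_leftShift (b k : ℕ) (S : Fin k → Cell) (P : Finset Cell) :
    rightShift b k S P = leftShift b k (fun i => S i.rev) P := by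
  have key : ∀ i, shiftRSeq b k S i = shiftLSeq b k (fun i => S i.rev) i.rev := fun i => by
    simp only [shiftRSeq, shiftLSeq, Fin.rev_rev, Fin.val_rev, Prod.mk.injEq, and_true]
    split_ifs with h₁ h₂ h₂
    · congr 2
      ext
      simp only [Fin.val_rev]
      omega
    · omega
    · omega
    · rfl
  ext p
  simp only [rightShift, leftShift, Finset.mem_union, Finset.mem_sdiff, Finset.mem_image,
    Finset.mem_univ, true_and, key]
  rw [← Fin.rev_surjective.exists (p := fun i => shiftLSeq b k (fun i => S i.rev) i = p),
    Fin.rev_surjective.exists (p := fun i => S i = p)]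

section
variable {α : Type*} [LinearOrder α] {g : ℕ → α} {L : List Cell} {P : Finset Cell}
  {a b k : ℕ} {S : Fin k → Cell}

theorem mem_filter_iff_colRestrict (hL : IsListing L P) (p : Cell) :
    p ∈ L.filter (fun p => a ≤ p.1 ∧ p.1 ≤ b) ↔ p ∈ colRestrict a b P := by
  simp [colRestrict, hL.mem_iff]

theorem mem_shift_iff (hS : ∀ i, S i ∈ colRestrict a b P) {v : List Cell} {d : ℕ}
    (hv : ∀ p, p ∈ v ↔ (p ∈ colRestrict a b P ∧ ∀ i, S i ≠ p) ∨ ∃ i, shiftLSeq d k S i = p)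
    (p : Cell) : p ∈ leftShift d k S P ↔ (p ∈ P ∧ ¬(a ≤ p.1 ∧ p.1 ≤ b)) ∨ p ∈ v := by
  rw [mem_leftShift, hv]
  have hS' : ¬(a ≤ p.1 ∧ p.1 ≤ b) → ∀ i, S i ≠ p := by
    rintro h i rfl
    exact h (Finset.mem_filter.1 (hS i)).2
  simp only [colRestrict, Finset.mem_filter]
  tauto

theorem IsListing.exists_leftShift (hL : IsListing L P) (hab : a ≤ b) (ha : ∀ p ∈ P, p.1 ≠ a)
    (hg : Function.Injective g)
    (hk : ∀ u v : List ℕ, KnuthEquiv (u.map g) (v.map g) → KnuthEquiv u v)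
    (hS : IsDecSeqOn (fun p : Cell => p.1) (fun p : Cell => g p.2) (colRestrict a b P) k S)
    (hmax : ∀ l (U : Fin l → Cell), IsDecSeqOn (fun p : Cell => p.1) (fun p : Cell => g p.2)
      (colRestrict a b P) l U → l ≤ k)
    (hmin : ∀ T, IsDecSeqOn (fun p : Cell => p.1) (fun p : Cell => g p.2) (colRestrict a b P) k T →
      (∀ i, g (T i).2 ≤ g (S i).2) → ∀ i, g (T i).2 = g (S i).2) :
    ∃ L', IsListing L' (leftShift a k S P) ∧ KnuthEquiv (L.map Prod.snd) (L'.map Prod.snd) := by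
  set w := L.filter fun p => a ≤ p.1 ∧ p.1 ≤ b with hw
  have hmem : ∀ p, p ∈ w ↔ p ∈ colRestrict a b P := mem_filter_iff_colRestrict hL
  have hW : ((colRestrict a b P : Finset Cell) : Set Cell) = {x | x ∈ w} := by
    ext p
    exact (hmem p).symm
  have hwab : ∀ p ∈ w, p.1 ≠ a ∧ a ≤ p.1 ∧ p.1 ≤ b := fun p hp =>
    have := Finset.mem_filter.1 ((hmem p).1 hp)
    ⟨ha p this.1, this.2⟩
  rw [hW] at hS hmax hmin
  obtain ⟨v, hv, hva, hvm, hvk⟩ := exists_shift id g hg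
    (fun p hp => lt_of_le_of_ne (hwab p hp).2.1 (hwab p hp).1.symm)
    (hL.sorted.filter _) (hL.nodup.sublist (List.filter_sublist.map _)) hS hmax hmin
  refine hL.splice (v := v) hab hv (fun p hp => ?_) (hk _ _ (by rw [List.map_map, List.map_map]; exact hvk))
    (mem_shift_iff (fun i => (hmem _).1 (hS.1 i)) fun p => by rw [hvm, ← hmem])
  rcases hva p hp with h | ⟨q, hq, h⟩
  · omega
  · rw [h]
    exact (hwab q hq).2

open OrderDual in
theorem IsListing.exists_rightShift (hL : IsListing L P) (hab : a ≤ b) (hb : ∀ p ∈ P, p.1 ≠ b)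
    (hg : Function.Injective g)
    (hk : ∀ u v : List ℕ, KnuthEquiv (u.map g) (v.map g) → KnuthEquiv u v)
    (hS : IsDecSeqOn (fun p : Cell => p.1) (fun p : Cell => g p.2) (colRestrict a b P) k S)
    (hmax : ∀ l (U : Fin l → Cell), IsDecSeqOn (fun p : Cell => p.1) (fun p : Cell => g p.2)
      (colRestrict a b P) l U → l ≤ k)
    (hmin : ∀ T, IsDecSeqOn (fun p : Cell => p.1) (fun p : Cell => g p.2) (colRestrict a b P) k T →
      (∀ i, g (S i).2 ≤ g (T i).2) → ∀ i, g (T i).2 = g (S i).2) :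
    ∃ L', IsListing L' (rightShift b k S P) ∧ KnuthEquiv (L.map Prod.snd) (L'.map Prod.snd) := by
  set w := L.filter fun p => a ≤ p.1 ∧ p.1 ≤ b with hw
  have hmem : ∀ p, p ∈ w ↔ p ∈ colRestrict a b P := mem_filter_iff_colRestrict hL
  have hW : ((colRestrict a b P : Finset Cell) : Set Cell) = {x | x ∈ w.reverse} := by
    ext p
    exact (hmem p).symm.trans List.mem_reverse.symm
  have hwab : ∀ p ∈ w, p.1 ≠ b ∧ a ≤ p.1 ∧ p.1 ≤ b := fun p hp =>
    have := Finset.mem_filter.1 ((hmem p).1 hp)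
    ⟨hb p this.1, this.2⟩
  have hrev : ∀ {l} {U : Fin l → Cell}, IsDecSeqOn (fun p : Cell => p.1) (fun p : Cell => g p.2)
      {x | x ∈ w.reverse} l U → IsDecSeqOn (fun p : Cell => toDual p.1)
        (fun p : Cell => toDual (g p.2)) {x | x ∈ w.reverse} l fun i => U i.rev :=
    fun h => ⟨fun i => h.1 _, fun i j hij => h.2 _ _ (Fin.rev_lt_rev.2 hij)⟩
  have hrev' : ∀ {l} {U : Fin l → Cell}, IsDecSeqOn (fun p : Cell => toDual p.1)
      (fun p : Cell => toDual (g p.2)) {x | x ∈ w.reverse} l U →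
        IsDecSeqOn (fun p : Cell => p.1) (fun p : Cell => g p.2)
      {x | x ∈ w.reverse} l fun i => U i.rev :=
    fun h => ⟨fun i => h.1 _, fun i j hij => h.2 _ _ (Fin.rev_lt_rev.2 hij)⟩
  rw [hW] at hS hmax hmin
  obtain ⟨v, hv, hva, hvm, hvk⟩ := exists_shift toDual (fun r => toDual (g r))
    (toDual.injective.comp hg) (a := b) (w := w.reverse)
    (fun p hp => toDual_lt_toDual.2 (lt_of_le_of_ne (hwab p (List.mem_reverse.1 hp)).2.2
      (hwab p (List.mem_reverse.1 hp)).1))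
    (List.pairwise_reverse.2 (hL.sorted.filter _))
    (by
      rw [List.map_reverse, List.nodup_reverse]
      exact hL.nodup.sublist (List.filter_sublist.map _))
    (hrev hS) (fun l U hU => hmax l _ (hrev' hU)) (fun T hT h i => by
      have := hmin _ (hrev' hT) (fun i => by simpa using h i.rev) i.rev
      simpa using this)
  rw [rightShift_eq_leftShift]
  have hvk' := hvk.ofDual.reverse
  refine hL.splice (v := v.reverse) hab (List.pairwise_reverse.2 hv) (fun p hp => ?_)
    (hk _ _ (by
      simp only [List.map_map, List.map_reverse, List.reverse_reverse] at hvk' ⊢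
      exact hvk'))
    (mem_shift_iff (fun i => (hmem _).1 (List.mem_reverse.1 (hS.1 _))) fun p => by
      rw [List.mem_reverse, hvm, ← hmem, List.mem_reverse])
  rcases hva p (List.mem_reverse.1 hp) with h | ⟨q, hq, h⟩
  · omega
  · rw [h]
    exact (hwab q (List.mem_reverse.1 hq)).2
end

theorem rowLexLE.eq_of_le {k : ℕ} {S T : Fin k → Cell} (h : rowLexLE k S T)
    (hle : ∀ i, (T i).2 ≤ (S i).2) (i : Fin k) : (T i).2 = (S i).2 := by
  rcases h with h | ⟨j, hj, -⟩
  · exact (h i).symm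
  · exact absurd (hle j) (not_le.2 hj)

open OrderDual in
theorem IsListing.exists_of_isGKT {L : List Cell} {P Q : Finset Cell} {m : ℕ}
    (hL : IsListing L P) (h : IsGKT m P Q) :
    ∃ L', IsListing L' Q ∧ KnuthEquiv (L.map Prod.snd) (L'.map Prod.snd) := by
  have hk : ∀ u v : List ℕ, KnuthEquiv (u.map id) (v.map id) → KnuthEquiv u v :=
    fun u v h => by simpa using h
  have hk' : ∀ u v : List ℕ, KnuthEquiv (u.map toDual) (v.map toDual) → KnuthEquiv u v :=
    fun u v h => by simpa using h.ofDual
  obtain ⟨a, b, -, hab, -, ⟨ha, k, S, h, rfl⟩ | ⟨hb, k, S, h, rfl⟩⟩ := h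
  · rcases h with ⟨⟨hS, hmax⟩, hle⟩ | ⟨⟨hS, hmax⟩, hle⟩
    · exact hL.exists_leftShift hab.le ha Function.injective_id hk hS hmax
        fun T hT h => (hle T hT).eq_of_le h
    · exact hL.exists_leftShift hab.le ha toDual.injective hk' hS hmax
        fun T hT h i => ((hle T hT).eq_of_le h i).symm
  · rcases h with ⟨⟨hS, hmax⟩, hle⟩ | ⟨⟨hS, hmax⟩, hle⟩
    · exact hL.exists_rightShift hab.le hb Function.injective_id hk hS hmax
        fun T hT h i => ((hle T hT).eq_of_le h i).symm
    · exact hL.exists_rightShift hab.le hb toDual.injective hk' hS hmax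
        fun T hT h => (hle T hT).eq_of_le h

/-- **Theorem (generalized Knuth equivalence).** If two rook placements `P` and `Q` on
the rectangular board `R(m,n)` differ by a sequence of generalized Knuth
transformations, then `ins(P) = ins(Q)`. -/
theorem ins_of_gkt (m n : ℕ) (P Q : Finset Cell)
    (hP : IsPlacement (Rect m n) P) (hQ : IsPlacement (Rect m n) Q)
    (h : Relation.ReflTransGen (IsGKT m) P Q) :
    insTab P = insTab Q := by
  have key : ∃ L, IsListing L Q ∧ insTab P = insWord [] (L.map Prod.snd) := by
    clear hQ
    induction h with
    | refl => exact ⟨_, isListing_rsSteps hP, (isListing_rsSteps hP).insTab_eq⟩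
    | tail _ h ih =>
      obtain ⟨L, hL, he⟩ := ih
      obtain ⟨L', hL', hk⟩ := hL.exists_of_isGKT h
      exact ⟨L', hL', he.trans hk.insWord_eq⟩
  obtain ⟨L, hL, he⟩ := key
  rw [he, hL.insTab_eq]
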